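/- arXiv:1710.07719 — 3 statements merged into one kernel-verified Lean document; each statement's English description precedes it below -/
import Mathlib

section
/- Fix c = e² − 3 and 0 < η < (ε − δ)/c. There is a constant M < ∞ depending only on ε (and δ, η) such that, for all (n,k) ∈ 𝒯 and all 0 ≤ u ≤ n − τ₀, almost surely P(|Y_u| ≥ δ (n − τ₀ − u) | 𝓕̂_0) ≤ 2 exp{−(ηδ/2)(n − τ₀)} + M exp{−ηδ (n − τ₀ − u)}. -/
open MeasureTheory ProbabilityTheory Finset

noncomputable section

namespace MultiSecretary

variable {Ω : Type*}

/-- `Z_j^r`: the number of candidates with ability `aj` among the first `r`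
(candidates are indexed `0, 1, …`, so `X 0, …, X (r-1)` are the first `r`). -/
def Zc (X : ℕ → Ω → ℝ) (aj : ℝ) (r : ℕ) (ω : Ω) : ℝ :=
  ∑ t ∈ range r, if X t ω = aj then 1 else 0

/-- `F̄(a_j) = f_1 + ⋯ + f_{j-1}`. -/
def Fbar (f : ℕ → ℝ) (j : ℕ) : ℝ := ∑ i ∈ Icc 1 (j - 1), f i

/-- The offline-sort count `𝔖_j^r = min { Z_j^r , (k - ∑_{i<j} Z_i^r)_+ }`. -/
def Soff (a : ℕ → ℝ) (X : ℕ → Ω → ℝ) (k r j : ℕ) (ω : Ω) : ℝ :=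
  min (Zc X (a j) r ω) (max ((k : ℝ) - ∑ i ∈ Icc 1 (j - 1), Zc X (a i) r ω) 0)

/-- The offline value `V_off^*(n,k) = ∑_j a_j E[𝔖_j^n]`. -/
def Voff [MeasurableSpace Ω] (μ : Measure Ω) (m : ℕ) (a : ℕ → ℝ) (X : ℕ → Ω → ℝ)
    (n k : ℕ) : ℝ :=
  ∑ j ∈ Icc 1 m, a j * ∫ ω, Soff a X k n j ω ∂μ

/-- The σ-field `𝓕_t` generated by the first `t` pairs `(X_s, U_s)`. -/
def Fil (X U : ℕ → Ω → ℝ) (t : ℕ) : MeasurableSpace Ω :=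
  MeasurableSpace.comap (fun ω => fun s : Fin t => (X s ω, U s ω)) inferInstance

/-- A feasible online policy for the `(n,k)` multi-secretary problem: `σp t` is the
(0/1-valued) decision about candidate `t` (0-indexed), measurable with respect to
`𝓕_{t+1} = σ(X_0,U_0,…,X_t,U_t)`, and at most `k` candidates are selected. -/
def IsPolicy (X U : ℕ → Ω → ℝ) (n k : ℕ) (σp : ℕ → Ω → ℕ) : Prop :=
  (∀ t ω, σp t ω ≤ 1) ∧
  (∀ t, Measurable[Fil X U (t + 1)] (σp t)) ∧
  (∀ ω, ∑ t ∈ range n, σp t ω ≤ k)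

/-- The value `V_on^π(n,k)` of an online policy. -/
def Von [MeasurableSpace Ω] (μ : Measure Ω) (X : ℕ → Ω → ℝ) (n : ℕ) (σp : ℕ → Ω → ℕ) : ℝ :=
  ∫ ω, (∑ t ∈ range n, X t ω * (σp t ω : ℝ)) ∂μ

/-- `V_on^*(n,k)`, the optimal value over feasible online policies. -/
def VonStar [MeasurableSpace Ω] (μ : Measure Ω) (X U : ℕ → Ω → ℝ) (n k : ℕ) : ℝ :=
  sSup {v : ℝ | ∃ σp, IsPolicy X U n k σp ∧ v = Von μ X n σp}

/-- `S_j^{π,r}`: the number of `a_j`-candidates selected by policy `π` among the first `r`. -/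
def Spol (a : ℕ → ℝ) (X : ℕ → Ω → ℝ) (σp : ℕ → Ω → ℕ) (j r : ℕ) (ω : Ω) : ℝ :=
  ∑ t ∈ range r, (σp t ω : ℝ) * (if X t ω = a j then 1 else 0)

/-- The Budget-Ratio thresholds: `T_1 = 0`, `T_j = (F̄(a_j)+F̄(a_{j+1}))/2` for `j ≥ 2`. -/
def Tthr (f : ℕ → ℝ) (j : ℕ) : ℝ := if j = 1 then 0 else (Fbar f j + Fbar f (j + 1)) / 2

/-- The index `j ∈ [m]` with `T_j ≤ x < T_{j+1}` (with `T_{m+1} = ∞`), i.e. the largest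
`j ∈ [m]` with `T_j ≤ x`. -/
def jBR (m : ℕ) (f : ℕ → ℝ) (x : ℝ) : ℕ :=
  ((Icc 1 m).filter fun j => Tthr f j ≤ x).sup id

/-- The remaining-budget process `K_t` of the Budget-Ratio policy: `K_0 = k`, and the
candidate `X_t` (presented at time `t+1`, 1-indexed) is selected iff `K_t > 0` and
`X_t > a_{j+1}` where `T_j ≤ K_t/(n-t) < T_{j+1}` (for `j = m`, i.e. `T_m ≤ K_t/(n-t)`,
every candidate is selected since `T_{m+1} = ∞` and `a_{m+1} < a_m`). -/
def Kbr (m : ℕ) (a f : ℕ → ℝ) (X : ℕ → Ω → ℝ) (n k : ℕ) : ℕ → Ω → ℕ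
  | 0, _ => k
  | t + 1, ω =>
    Kbr m a f X n k t ω -
      (if 0 < Kbr m a f X n k t ω ∧
          (jBR m f ((Kbr m a f X n k t ω : ℝ) / ((n : ℝ) - t)) = m ∨
            a (jBR m f ((Kbr m a f X n k t ω : ℝ) / ((n : ℝ) - t)) + 1) < X t ω)
        then 1 else 0)

/-- The selection decisions `σ^br` of the Budget-Ratio policy (0-indexed candidates). -/
def σbr (m : ℕ) (a f : ℕ → ℝ) (X : ℕ → Ω → ℝ) (n k : ℕ) (t : ℕ) (ω : Ω) : ℕ :=
  Kbr m a f X n k t ω - Kbr m a f X n k (t + 1) ω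

/-- The Bernoulli selection indicators `B_t` of a non-adaptive policy `p = (p_{j,t})`. -/
def Bna (m : ℕ) (a : ℕ → ℝ) (p : ℕ → ℕ → ℝ) (X U : ℕ → Ω → ℝ) (t : ℕ) (ω : Ω) : ℝ :=
  ∑ j ∈ Icc 1 m, if U t ω ≤ p j t ∧ X t ω = a j then 1 else 0

/-- The stopping time `ν = min{ r ≥ 1 : B_1 + ⋯ + B_r ≥ k or r ≥ n }` of a
non-adaptive policy. -/
def nuNA (m : ℕ) (a : ℕ → ℝ) (p : ℕ → ℕ → ℝ) (X U : ℕ → Ω → ℝ) (n k : ℕ) (ω : Ω) : ℕ :=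
  sInf {r : ℕ | 1 ≤ r ∧ ((k : ℝ) ≤ ∑ t ∈ range r, Bna m a p X U t ω ∨ n ≤ r)}

/-- The value `V_on^π(n,k) = ∑_j a_j E[∑_{t ≤ ν} B_t 1(X_t = a_j)]` of a non-adaptive policy. -/
def VonNA [MeasurableSpace Ω] (μ : Measure Ω) (m : ℕ) (a : ℕ → ℝ) (p : ℕ → ℕ → ℝ)
    (X U : ℕ → Ω → ℝ) (n k : ℕ) : ℝ :=
  ∑ j ∈ Icc 1 m, a j *
    ∫ ω, (∑ t ∈ range (nuNA m a p X U n k ω), if X t ω = a j then Bna m a p X U t ω else 0) ∂μ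

/-- `V_na^*(n,k)`: the optimal value over non-adaptive policies. -/
def VnaStar [MeasurableSpace Ω] (μ : Measure Ω) (m : ℕ) (a : ℕ → ℝ) (X U : ℕ → Ω → ℝ)
    (n k : ℕ) : ℝ :=
  sSup {v : ℝ | ∃ p : ℕ → ℕ → ℝ,
    (∀ j t, 0 ≤ p j t ∧ p j t ≤ 1) ∧ v = VonNA μ m a p X U n k}

/-- The deterministic relaxation `DR(n,k)`. -/
def DRval (m : ℕ) (a f : ℕ → ℝ) (n k : ℕ) : ℝ :=
  sSup {v : ℝ | ∃ s : ℕ → ℝ,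
    (∀ j ∈ Icc 1 m, 0 ≤ s j ∧ s j ≤ (n : ℝ) * f j) ∧
    (∑ j ∈ Icc 1 m, s j) ≤ (k : ℝ) ∧ v = ∑ j ∈ Icc 1 m, a j * s j}

/-- The optimal solution `s_j^* = min{ n f_j, (k - n F̄(a_j))_+ }` of the deterministic
relaxation. -/
def sStar (f : ℕ → ℝ) (n k j : ℕ) : ℝ :=
  min ((n : ℝ) * f j) (max ((k : ℝ) - (n : ℝ) * Fbar f j) 0)

/-- `J0Spec m f n k j` says that `j = j₀(n,k)`, the action index of `(n,k)`. -/
def J0Spec (m : ℕ) (f : ℕ → ℝ) (n k j : ℕ) : Prop :=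
  (j = 1 ∧ (k : ℝ) / (n : ℝ) < f 1 + f 2 / 2) ∨
  (1 ≤ j ∧ j + 1 ≤ m ∧ Fbar f j + f j / 2 ≤ (k : ℝ) / (n : ℝ) ∧
    (k : ℝ) / (n : ℝ) < Fbar f (j + 2) - f (j + 1) / 2) ∨
  (j = m ∧ 1 - f m / 2 ≤ (k : ℝ) / (n : ℝ))

/-- The budget ratio `K_t / (n - t)`. -/
def ratio (K : ℕ → Ω → ℕ) (n t : ℕ) (ω : Ω) : ℝ := (K t ω : ℝ) / ((n : ℝ) - t)

/-- The time `τ₀` at which the budget ratio first enters the `δ/2`-orbit of a threshold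
(or the deterministic time `n - 2δ⁻¹ - 1` is reached). -/
def tau0 (m : ℕ) (f : ℕ → ℝ) (δ : ℝ) (K : ℕ → Ω → ℕ) (n : ℕ) (ω : Ω) : ℕ :=
  sInf {t : ℕ |
    (∃ j ∈ Icc 1 m, |ratio K n t ω - Tthr f j| ≤ δ / 2) ∨ (n : ℝ) - 2 / δ - 1 ≤ (t : ℝ)}

/-- The index `j(τ₀)` of the threshold entered at time `τ₀` (set to `m+1`, corresponding to
`T_{j(τ₀)} = ∞`, when `τ₀ ≥ n - 2δ⁻¹ - 1`). -/
def jTau0 (m : ℕ) (f : ℕ → ℝ) (δ : ℝ) (K : ℕ → Ω → ℕ) (n : ℕ) (ω : Ω) : ℕ :=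
  if (tau0 m f δ K n ω : ℝ) < (n : ℝ) - 2 / δ - 1 then
    sInf {j : ℕ | j ∈ Icc 1 m ∧ |ratio K n (tau0 m f δ K n ω) ω - Tthr f j| ≤ δ / 2}
  else m + 1

/-- The exit time `τ = inf{ t > τ₀ : |K_t/(n-t) - T_{j(τ₀)}| > δ or t ≥ n - 2δ⁻¹ - 1 }`
(for `j(τ₀) = m + 1`, i.e. `T_{j(τ₀)} = ∞`, the first condition is vacuous). -/
def tauBR (m : ℕ) (f : ℕ → ℝ) (δ : ℝ) (K : ℕ → Ω → ℕ) (n : ℕ) (ω : Ω) : ℕ :=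
  sInf {t : ℕ | tau0 m f δ K n ω < t ∧
    ((n : ℝ) - 2 / δ - 1 ≤ (t : ℝ) ∨
      (jTau0 m f δ K n ω ≤ m ∧ δ < |ratio K n t ω - Tthr f (jTau0 m f δ K n ω)|))}

/-- The deviation process `Y_u = K_{τ₀+u} - T_{j(τ₀)} (n - τ₀ - u)`. -/
def Ydev (m : ℕ) (f : ℕ → ℝ) (δ : ℝ) (K : ℕ → Ω → ℕ) (n : ℕ) (u : ℕ) (ω : Ω) : ℝ :=
  (K (tau0 m f δ K n ω + u) ω : ℝ) -
    Tthr f (jTau0 m f δ K n ω) * ((n : ℝ) - (tau0 m f δ K n ω : ℝ) - (u : ℝ))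

/-- The minimal mass `min{f_1, …, f_m}` of the ability distribution. -/
def minf (m : ℕ) (f : ℕ → ℝ) : ℝ := sInf {x : ℝ | ∃ j, 1 ≤ j ∧ j ≤ m ∧ x = f j}

/-- The standing model hypotheses of the multi-secretary problem: the abilities
`0 < a_m < ⋯ < a_1`, the probability mass function `f`, and the i.i.d. sequence of
abilities `X_t` together with the auxiliary i.i.d. uniform randomization variables `U_t`. -/
structure Model [MeasurableSpace Ω] (μ : Measure Ω) (m : ℕ) (a f : ℕ → ℝ)
    (X U : ℕ → Ω → ℝ) : Prop where
  hm : 1 ≤ m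
  ha_anti : ∀ j, 1 ≤ j → j < m → a (j + 1) < a j
  ha_pos : 0 < a m
  hf_pos : ∀ j, 1 ≤ j → j ≤ m → 0 < f j
  hf_sum : ∑ j ∈ Icc 1 m, f j = 1
  hprob : IsProbabilityMeasure μ
  hXmeas : ∀ t, Measurable (X t)
  hUmeas : ∀ t, Measurable (U t)
  hXdist : ∀ t j, 1 ≤ j → j ≤ m → μ {ω | X t ω = a j} = ENNReal.ofReal (f j)
  hUdist : ∀ t, μ.map (U t) = volume.restrict (Set.Icc (0 : ℝ) 1)
  hIndep : iIndepFun (fun t ω => (X t ω, U t ω)) μ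
  hXUIndep : ∀ t, IndepFun (X t) (U t) μ

/-- The standing model hypotheses with only the ability sequence `X` (no auxiliary
randomization). -/
structure ModelX [MeasurableSpace Ω] (μ : Measure Ω) (m : ℕ) (a f : ℕ → ℝ)
    (X : ℕ → Ω → ℝ) : Prop where
  hm : 1 ≤ m
  ha_anti : ∀ j, 1 ≤ j → j < m → a (j + 1) < a j
  ha_pos : 0 < a m
  hf_pos : ∀ j, 1 ≤ j → j ≤ m → 0 < f j
  hf_sum : ∑ j ∈ Icc 1 m, f j = 1
  hprob : IsProbabilityMeasure μ
  hXmeas : ∀ t, Measurable (X t)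
  hXdist : ∀ t j, 1 ≤ j → j ≤ m → μ {ω | X t ω = a j} = ENNReal.ofReal (f j)
  hIndep : iIndepFun X μ


/-! ### Elementary facts about the model -/

lemma Fbar_succ (f : ℕ → ℝ) (j : ℕ) (hj : 1 ≤ j) : Fbar f (j + 1) = Fbar f j + f j := by
  obtain ⟨i, rfl⟩ : ∃ i, j = i + 1 := ⟨j - 1, by omega⟩
  unfold Fbar
  rw [show i + 1 + 1 - 1 = i + 1 by omega, show i + 1 - 1 = i by omega,
    Finset.sum_Icc_succ_top (by omega)]

section det
variable {m : ℕ} {a f : ℕ → ℝ}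

lemma Fbar_nonneg (hf : ∀ j, 1 ≤ j → j ≤ m → 0 < f j) (j : ℕ) (hj : j ≤ m + 1) :
    0 ≤ Fbar f j := by
  unfold Fbar
  apply Finset.sum_nonneg
  intro i hi
  rw [Finset.mem_Icc] at hi
  exact (hf i (by omega) (by omega)).le

lemma Fbar_le_one (hf : ∀ j, 1 ≤ j → j ≤ m → 0 < f j) (hs : ∑ j ∈ Icc 1 m, f j = 1)
    (j : ℕ) (hj : j ≤ m + 1) : Fbar f j ≤ 1 := by
  unfold Fbar
  rw [← hs]
  apply Finset.sum_le_sum_of_subset_of_nonneg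
  · apply Finset.Icc_subset_Icc le_rfl; omega
  · intro i hi _
    rw [Finset.mem_Icc] at hi
    exact (hf i (by omega) (by omega)).le

lemma sum_tail (hs : ∑ j ∈ Icc 1 m, f j = 1) (j : ℕ) (hj : 1 ≤ j) (hjm : j ≤ m) :
    ∑ l ∈ Icc j m, f l = 1 - Fbar f j := by
  unfold Fbar
  rw [← hs, eq_sub_iff_add_eq, add_comm]
  rw [← Finset.sum_union]
  · congr 1
    ext x
    simp only [Finset.mem_union, Finset.mem_Icc]
    omega
  · rw [Finset.disjoint_left]
    intro x hx hy
    simp only [Finset.mem_Icc] at hx hy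
    omega

lemma Tthr_nonneg (hf : ∀ j, 1 ≤ j → j ≤ m → 0 < f j) (j : ℕ) (hjm : j ≤ m) :
    0 ≤ Tthr f j := by
  unfold Tthr
  split_ifs
  · exact le_rfl
  · have := Fbar_nonneg hf j (by omega)
    have := Fbar_nonneg hf (j + 1) (by omega)
    linarith

lemma Tthr_le_one (hf : ∀ j, 1 ≤ j → j ≤ m → 0 < f j) (hs : ∑ j ∈ Icc 1 m, f j = 1)
    (j : ℕ) (hjm : j ≤ m) : Tthr f j ≤ 1 := by
  unfold Tthr
  split_ifs
  · exact zero_le_one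
  · have := Fbar_le_one hf hs j (by omega)
    have := Fbar_le_one hf hs (j + 1) (by omega)
    linarith

lemma Fbar_mono (hf : ∀ j, 1 ≤ j → j ≤ m → 0 < f j) {i j : ℕ} (hij : i ≤ j)
    (hjm : j ≤ m + 1) : Fbar f i ≤ Fbar f j := by
  unfold Fbar
  apply Finset.sum_le_sum_of_subset_of_nonneg
  · apply Finset.Icc_subset_Icc le_rfl; omega
  · intro i hi _
    rw [Finset.mem_Icc] at hi
    exact (hf i (by omega) (by omega)).le

lemma Tthr_mono (hf : ∀ j, 1 ≤ j → j ≤ m → 0 < f j) {i j : ℕ} (hi : 1 ≤ i) (hij : i ≤ j)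
    (hjm : j ≤ m) : Tthr f i ≤ Tthr f j := by
  by_cases h1 : i = 1
  · have : Tthr f i = 0 := by simp [Tthr, h1]
    rw [this]; exact Tthr_nonneg hf j hjm
  · unfold Tthr
    rw [if_neg h1, if_neg (by omega)]
    have := Fbar_mono hf hij (by omega)
    have := Fbar_mono hf (show i + 1 ≤ j + 1 by omega) (by omega)
    linarith

lemma Tthr_drift_up (hf : ∀ j, 1 ≤ j → j ≤ m → 0 < f j) (j : ℕ) (hj : 1 ≤ j) (hjm : j ≤ m) :
    Tthr f j - Fbar f (j + 1) ≤ - (f j / 2) := by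
  have h0 := hf j hj hjm
  have h1 := Fbar_succ f j hj
  have h2 := Fbar_nonneg hf j (by omega)
  unfold Tthr
  split_ifs <;> linarith

lemma Tthr_drift_down (j : ℕ) (hj : 1 < j) :
    Fbar f j - Tthr f j = - (f j / 2) := by
  have h1 := Fbar_succ f j (by omega)
  unfold Tthr
  rw [if_neg (by omega)]; linarith

lemma a_anti (ha : ∀ j, 1 ≤ j → j < m → a (j + 1) < a j) {i l : ℕ} (hi : 1 ≤ i) (hil : i ≤ l)
    (hlm : l ≤ m) : a l ≤ a i := by
  induction l, hil using Nat.le_induction with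
  | base => exact le_rfl
  | succ l hl ih => exact (ha l (by omega) (by omega)).le.trans (ih (by omega))

lemma a_anti_strict (ha : ∀ j, 1 ≤ j → j < m → a (j + 1) < a j) {i l : ℕ} (hi : 1 ≤ i)
    (hil : i < l) (hlm : l ≤ m) : a l < a i :=
  (a_anti ha (show 1 ≤ i + 1 by omega) hil hlm).trans_lt (ha i hi (by omega))

lemma jBR_le (x : ℝ) : jBR m f x ≤ m := by
  unfold jBR
  apply Finset.sup_le
  intro i hi
  simp only [Finset.mem_filter, Finset.mem_Icc] at hi
  exact hi.1.2

lemma le_jBR {x : ℝ} {j : ℕ} (hj : 1 ≤ j) (hjm : j ≤ m) (h : Tthr f j ≤ x) : j ≤ jBR m f x := by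
  unfold jBR
  exact Finset.le_sup (f := id) (by simp only [Finset.mem_filter, Finset.mem_Icc]; exact ⟨⟨hj, hjm⟩, h⟩)

lemma jBR_lt (hf : ∀ j, 1 ≤ j → j ≤ m → 0 < f j) {x : ℝ} {j : ℕ} (hj : 1 ≤ j)
    (h : x < Tthr f j) : jBR m f x < j := by
  unfold jBR
  rw [Finset.sup_lt_iff (by exact hj)]
  intro i hi
  simp only [Finset.mem_filter, Finset.mem_Icc] at hi
  by_contra hc
  have hc' : j ≤ i := not_lt.mp hc
  have := Tthr_mono hf hj hc' hi.1.2
  linarith [hi.2]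

variable (X : ℕ → Ω → ℝ) (n k : ℕ)

lemma K_step (t : ℕ) (ω : Ω) : Kbr m a f X n k (t + 1) ω = Kbr m a f X n k t ω ∨
    Kbr m a f X n k (t + 1) ω + 1 = Kbr m a f X n k t ω := by
  rw [Kbr]
  split_ifs with h
  · right; omega
  · left; omega

lemma K_le (t : ℕ) (ω : Ω) : Kbr m a f X n k t ω ≤ k := by
  induction t with
  | zero => exact le_rfl
  | succ t ih => rcases K_step (m := m) (a := a) (f := f) X n k t ω with h | h <;> omega

lemma K_step_up (ha : ∀ j, 1 ≤ j → j < m → a (j + 1) < a j)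
    (hf : ∀ j, 1 ≤ j → j ≤ m → 0 < f j) {t j : ℕ} (ω : Ω) (htn : t < n)
    (hj : 1 ≤ j) (hjm : j ≤ m)
    (hY : 1 ≤ (Kbr m a f X n k t ω : ℝ) - Tthr f j * ((n : ℝ) - t))
    (hX : ∃ l ∈ Icc 1 j, X t ω = a l) :
    Kbr m a f X n k (t + 1) ω + 1 = Kbr m a f X n k t ω := by
  have hnt : (0 : ℝ) < (n : ℝ) - t := by
    have : (t : ℝ) < n := by exact_mod_cast htn
    linarith
  have hT := Tthr_nonneg hf j hjm
  have hK : 0 < Kbr m a f X n k t ω := by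
    have : (0 : ℝ) < Kbr m a f X n k t ω := by nlinarith
    exact_mod_cast this
  have hr : Tthr f j ≤ (Kbr m a f X n k t ω : ℝ) / ((n : ℝ) - t) := by
    rw [le_div_iff₀ hnt]; linarith
  have hi := le_jBR hj hjm hr
  have him := jBR_le (m := m) (f := f) ((Kbr m a f X n k t ω : ℝ) / ((n : ℝ) - t))
  rw [Kbr, if_pos]
  · omega
  · refine ⟨hK, ?_⟩
    rcases him.eq_or_lt with h | h
    · exact Or.inl h
    · right
      obtain ⟨l, hl, hX⟩ := hX
      rw [Finset.mem_Icc] at hl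
      rw [hX]
      exact a_anti_strict ha hl.1 (by omega) h

lemma K_step_down (ha : ∀ j, 1 ≤ j → j < m → a (j + 1) < a j)
    (hf : ∀ j, 1 ≤ j → j ≤ m → 0 < f j) {t j : ℕ} (ω : Ω) (htn : t < n)
    (hj : 1 ≤ j) (hjm : j ≤ m)
    (hY : (Kbr m a f X n k t ω : ℝ) - Tthr f j * ((n : ℝ) - t) ≤ -1)
    (hX : ∃ l ∈ Icc j m, X t ω = a l) :
    Kbr m a f X n k (t + 1) ω = Kbr m a f X n k t ω := by
  have hnt : (0 : ℝ) < (n : ℝ) - t := by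
    have : (t : ℝ) < n := by exact_mod_cast htn
    linarith
  have hr : (Kbr m a f X n k t ω : ℝ) / ((n : ℝ) - t) < Tthr f j := by
    rw [div_lt_iff₀ hnt]; linarith
  have hi := jBR_lt hf hj hr
  rw [Kbr, if_neg]
  · omega
  · rintro ⟨-, h | h⟩
    · omega
    · obtain ⟨l, hl, hX⟩ := hX
      rw [Finset.mem_Icc] at hl
      rw [hX] at h
      have := a_anti ha (i := jBR m f ((Kbr m a f X n k t ω : ℝ) / ((n : ℝ) - t)) + 1)
        (l := l) (by omega) (by omega) hl.2
      linarith

end det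

/-! ### Measurability -/

lemma Fil_mono (X U : ℕ → Ω → ℝ) {s t : ℕ} (hst : s ≤ t) : Fil X U s ≤ Fil X U t := by
  unfold Fil
  have : (fun ω => fun i : Fin s => (X i ω, U i ω)) =
      (fun (v : Fin t → ℝ × ℝ) => fun i : Fin s => v (Fin.castLE hst i)) ∘
        (fun ω => fun i : Fin t => (X i ω, U i ω)) := by
    ext ω i <;> simp
  rw [this, ← MeasurableSpace.comap_comp]
  apply MeasurableSpace.comap_mono
  apply Measurable.comap_le
  fun_prop

lemma Fil_le [MeasurableSpace Ω] (X U : ℕ → Ω → ℝ) (hX : ∀ t, Measurable (X t))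
    (hU : ∀ t, Measurable (U t)) (t : ℕ) : Fil X U t ≤ ‹MeasurableSpace Ω› := by
  unfold Fil
  apply Measurable.comap_le
  fun_prop

lemma X_meas_Fil (X U : ℕ → Ω → ℝ) (t : ℕ) : Measurable[Fil X U (t + 1)] (X t) := by
  have h : Measurable[Fil X U (t + 1)]
      (fun ω => fun i : Fin (t + 1) => (X i ω, U i ω)) := comap_measurable _
  have h2 : Measurable (fun v : Fin (t + 1) → ℝ × ℝ => (v (Fin.last t)).1) := by fun_prop
  have := h2.comp h
  simpa [Function.comp_def] using this

lemma K_meas (m : ℕ) (a f : ℕ → ℝ) (X U : ℕ → Ω → ℝ) (n k t : ℕ) :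
    Measurable[Fil X U t] (Kbr m a f X n k t) := by
  induction t with
  | zero => exact measurable_const
  | succ t ih =>
    have h1 : Measurable[Fil X U (t + 1)] (Kbr m a f X n k t) :=
      ih.mono (Fil_mono X U (Nat.le_succ t)) le_rfl
    have h2 := X_meas_Fil X U t
    have h3 : Measurable (fun p : ℕ × ℝ => p.1 -
      (if 0 < p.1 ∧ (jBR m f ((p.1 : ℝ) / ((n : ℝ) - t)) = m ∨
            a (jBR m f ((p.1 : ℝ) / ((n : ℝ) - t)) + 1) < p.2) then 1 else 0)) := by
      apply measurable_from_prod_countable_right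
      intro x
      apply Measurable.const_sub
      apply Measurable.ite _ measurable_const measurable_const
      have e : {y : ℝ | 0 < x ∧ (jBR m f ((x : ℝ) / ((n : ℝ) - t)) = m ∨
          a (jBR m f ((x : ℝ) / ((n : ℝ) - t)) + 1) < y)} =
          {y : ℝ | 0 < x} ∩ ({y : ℝ | jBR m f ((x : ℝ) / ((n : ℝ) - t)) = m} ∪
            {y : ℝ | a (jBR m f ((x : ℝ) / ((n : ℝ) - t)) + 1) < y}) := rfl
      refine e ▸ ?_
      exact (MeasurableSet.const _).inter ((MeasurableSet.const _).union
        (measurableSet_lt measurable_const measurable_id))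
    exact h3.comp (h1.prodMk h2)

lemma indep_Fil [MeasurableSpace Ω] {μ : Measure Ω} {m : ℕ} {a f : ℕ → ℝ} {X U : ℕ → Ω → ℝ}
    (hM : Model μ m a f X U) (t : ℕ) :
    Indep (Fil X U t) (MeasurableSpace.comap (X t) inferInstance) μ := by
  have hm : ∀ i, Measurable (fun ω => (X i ω, U i ω)) := fun i =>
    (hM.hXmeas i).prodMk (hM.hUmeas i)
  have h := hM.hIndep.indepFun_finset (Finset.range t) {t} (by simp) hm
  have h2 := h.comp
    (φ := fun (v : Finset.range t → ℝ × ℝ) => fun i : Fin t =>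
      v ⟨i, Finset.mem_range.mpr i.2⟩)
    (ψ := fun (v : ({t} : Finset ℕ) → ℝ × ℝ) => (v ⟨t, Finset.mem_singleton_self t⟩).1) (by fun_prop) (by fun_prop)
  exact h2

lemma prob_mem [MeasurableSpace Ω] {μ : Measure Ω} {m : ℕ} {a f : ℕ → ℝ} {X U : ℕ → Ω → ℝ}
    (hM : Model μ m a f X U) (t : ℕ) (s : Finset ℕ) (hs : s ⊆ Icc 1 m) :
    μ.real {ω | ∃ l ∈ s, X t ω = a l} = ∑ l ∈ s, f l := by
  have := hM.hprob
  have e : {ω | ∃ l ∈ s, X t ω = a l} = ⋃ l ∈ s, {ω | X t ω = a l} := by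
    ext ω; simp
  rw [e, measureReal_biUnion_finset]
  · apply Finset.sum_congr rfl
    intro l hl
    have := hs hl
    rw [Finset.mem_Icc] at this
    rw [Measure.real, hM.hXdist t l this.1 this.2,
      ENNReal.toReal_ofReal (hM.hf_pos l this.1 this.2).le]
  · intro i hi l hl hil
    rw [Function.onFun, Set.disjoint_left]
    intro ω h1 h2
    simp only [Set.mem_ofPred_eq] at h1 h2
    have hi' := Finset.mem_Icc.mp (hs hi)
    have hl' := Finset.mem_Icc.mp (hs hl)
    rcases lt_or_gt_of_ne hil with h | h
    · have := a_anti_strict hM.ha_anti hi'.1 h hl'.2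
      linarith
    · have := a_anti_strict hM.ha_anti hl'.1 h hi'.2
      linarith
  · intro l _
    exact hM.hXmeas t (measurableSet_singleton _)

lemma setIntegral_indep [MeasurableSpace Ω] {μ : Measure Ω} {m : ℕ} {a f : ℕ → ℝ}
    {X U : ℕ → Ω → ℝ} (hM : Model μ m a f X U) (t : ℕ) (s : Finset ℕ) (hs : s ⊆ Icc 1 m)
    (S : Set Ω) (hS : MeasurableSet[Fil X U t] S) (W : Ω → ℝ) (hW : Measurable[Fil X U t] W) :
    ∫ ω in S, W ω * ({ω | ∃ l ∈ s, X t ω = a l}.indicator (fun _ => (1 : ℝ)) ω) ∂μ =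
      (∑ l ∈ s, f l) * ∫ ω in S, W ω ∂μ := by
  have := hM.hprob
  have hle := Fil_le X U hM.hXmeas hM.hUmeas t
  set E := {ω | ∃ l ∈ s, X t ω = a l} with hE
  have hEX : MeasurableSet[MeasurableSpace.comap (X t) inferInstance] E := by
    refine ⟨a '' s, (s.finite_toSet.image a).measurableSet, ?_⟩
    ext ω
    simp only [hE, Set.mem_preimage, Set.mem_image, Set.mem_ofPred_eq, Finset.mem_coe, eq_comm]
  have hEm : MeasurableSet E := (hM.hXmeas t).comap_le _ hEX
  have hind : IndepFun (S.indicator W) (E.indicator (fun _ => (1 : ℝ))) μ := by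
    have h := indep_Fil hM t
    rw [IndepFun_iff_Indep]
    refine indep_of_indep_of_le_left (indep_of_indep_of_le_right h ?_) ?_
    · exact Measurable.comap_le (measurable_const.indicator hEX)
    · exact Measurable.comap_le (hW.indicator hS)
  have h := hind.integral_mul_eq_mul_integral
    ((hW.indicator hS).mono hle le_rfl).aestronglyMeasurable
    (measurable_const.indicator hEm).aestronglyMeasurable
  rw [integral_indicator (hle _ hS), show (∫ x, E.indicator (fun _ => (1 : ℝ)) x ∂μ) = μ.real E from
      integral_indicator_one hEm, prob_mem hM t s hs] at h
  rw [mul_comm, ← h, ← integral_indicator (hle _ hS)]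
  congr 1
  ext ω
  by_cases hω : ω ∈ S <;> simp [hω]

/-! ### The drift inequality -/

lemma exp_bound {η d d' : ℝ} (h0 : 0 < η) (h1 : η ≤ 1) (hd : |d| ≤ 1) (hdd : d ≤ d') :
    Real.exp (η * d) ≤ 1 + η * d' + η ^ 2 := by
  have hx : |η * d| ≤ 1 := by
    rw [abs_mul, abs_of_pos h0]
    calc η * |d| ≤ 1 * 1 := mul_le_mul h1 hd (abs_nonneg _) zero_le_one
      _ = 1 := by norm_num
  have h2 := (abs_le.mp (Real.abs_exp_sub_one_sub_id_le hx)).2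
  have h3 : d ^ 2 ≤ 1 := by
    rw [← sq_abs]; exact pow_le_one₀ (abs_nonneg _) hd
  have h4 : η * d ≤ η * d' := by gcongr
  have h5 : (η * d) ^ 2 ≤ η ^ 2 := by
    rw [mul_pow]; nlinarith [sq_nonneg η]
  linarith

/-- Exponential Lyapunov function. -/
def Wf (m : ℕ) (a f : ℕ → ℝ) (X : ℕ → Ω → ℝ) (n k : ℕ) (η : ℝ) (j t : ℕ) (ω : Ω) : ℝ :=
  Real.exp (η * |(Kbr m a f X n k t ω : ℝ) - Tthr f j * ((n : ℝ) - t)|)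

lemma Wf_pos (m : ℕ) (a f : ℕ → ℝ) (X : ℕ → Ω → ℝ) (n k : ℕ) (η : ℝ) (j t : ℕ) (ω : Ω) :
    0 < Wf m a f X n k η j t ω := Real.exp_pos _

lemma Wf_meas (m : ℕ) (a f : ℕ → ℝ) (X U : ℕ → Ω → ℝ) (n k : ℕ) (η : ℝ) (j t : ℕ) :
    Measurable[Fil X U t] (Wf m a f X n k η j t) := by
  have h : Measurable (fun x : ℕ => Real.exp (η * |(x : ℝ) - Tthr f j * ((n : ℝ) - t)|)) :=
    measurable_from_nat
  exact h.comp (K_meas m a f X U n k t)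

lemma Wf_int [MeasurableSpace Ω] {μ : Measure Ω} {m : ℕ} {a f : ℕ → ℝ} {X U : ℕ → Ω → ℝ}
    (hM : Model μ m a f X U) (n k : ℕ) {η : ℝ} (hη : 0 < η) (j t : ℕ) :
    Integrable (Wf m a f X n k η j t) μ := by
  have := hM.hprob
  have hm := (Wf_meas m a f X U n k η j t).mono (Fil_le X U hM.hXmeas hM.hUmeas t) le_rfl
  refine Integrable.of_bound hm.aestronglyMeasurable
    (Real.exp (η * ((k : ℝ) + |Tthr f j * ((n : ℝ) - t)|))) (Filter.Eventually.of_forall ?_)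
  intro ω
  rw [Real.norm_of_nonneg (Wf_pos _ _ _ _ _ _ _ _ _ _).le]
  unfold Wf
  apply Real.exp_le_exp.mpr
  apply mul_le_mul_of_nonneg_left _ hη.le
  refine (abs_sub _ _).trans ?_
  have : (Kbr m a f X n k t ω : ℝ) ≤ k := by exact_mod_cast K_le X n k t ω
  rw [Nat.abs_cast]
  linarith

section drift
variable [MeasurableSpace Ω] {μ : Measure Ω} {m : ℕ} {a f : ℕ → ℝ} {X U : ℕ → Ω → ℝ}

lemma Wf_up (hM : Model μ m a f X U) (n k : ℕ) {η : ℝ} (h0 : 0 < η) (h1 : η ≤ 1)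
    {j t : ℕ} (hj : 1 ≤ j) (hjm : j ≤ m) (htn : t < n) (ω : Ω)
    (hY : 1 ≤ (Kbr m a f X n k t ω : ℝ) - Tthr f j * ((n : ℝ) - t)) :
    Wf m a f X n k η j (t + 1) ω ≤ (1 + η * Tthr f j + η ^ 2) * Wf m a f X n k η j t ω
      - η * (Wf m a f X n k η j t ω *
        ({ω | ∃ l ∈ Icc 1 j, X t ω = a l}.indicator (fun _ => (1 : ℝ)) ω)) := by
  set E := {ω | ∃ l ∈ Icc 1 j, X t ω = a l} with hE
  have hT0 := Tthr_nonneg hM.hf_pos j hjm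
  have hT1 := Tthr_le_one hM.hf_pos hM.hf_sum j hjm
  set y := (Kbr m a f X n k t ω : ℝ) - Tthr f j * ((n : ℝ) - t) with hy
  set d := (Kbr m a f X n k (t + 1) ω : ℝ) - Kbr m a f X n k t ω + Tthr f j with hd
  have hyd : (Kbr m a f X n k (t + 1) ω : ℝ) - Tthr f j * ((n : ℝ) - ((t + 1 : ℕ) : ℝ)) = y + d := by
    rw [hy, hd]; push_cast; ring
  have hstep : (Kbr m a f X n k (t + 1) ω : ℝ) = Kbr m a f X n k t ω ∨
      (Kbr m a f X n k (t + 1) ω : ℝ) + 1 = Kbr m a f X n k t ω := by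
    rcases K_step (m := m) (a := a) (f := f) X n k t ω with h | h
    · left; rw [h]
    · right; exact_mod_cast h
  have hd1 : |d| ≤ 1 := by
    rw [abs_le]
    rcases hstep with h | h <;> constructor <;> linarith
  have hd2 : d ≤ Tthr f j - E.indicator (fun _ => (1 : ℝ)) ω := by
    by_cases hω : ω ∈ E
    · have h := K_step_up X n k hM.ha_anti hM.hf_pos ω htn hj hjm hY hω
      have h' : (Kbr m a f X n k (t + 1) ω : ℝ) + 1 = Kbr m a f X n k t ω := by exact_mod_cast h
      rw [Set.indicator_of_mem hω]
      linarith
    · rw [Set.indicator_of_notMem hω]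
      rcases hstep with h | h <;> linarith
  have key := exp_bound h0 h1 hd1 hd2
  have e1 : Wf m a f X n k η j (t + 1) ω = Wf m a f X n k η j t ω * Real.exp (η * d) := by
    unfold Wf
    rw [hyd, ← hy, ← Real.exp_add, abs_of_nonneg (by linarith [(abs_le.mp hd1).1]),
      abs_of_nonneg (by linarith)]
    ring_nf
  rw [e1]
  have := mul_le_mul_of_nonneg_left key (Wf_pos m a f X n k η j t ω).le
  linarith

lemma Wf_down (hM : Model μ m a f X U) (n k : ℕ) {η : ℝ} (h0 : 0 < η) (h1 : η ≤ 1)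
    {j t : ℕ} (hj : 1 ≤ j) (hjm : j ≤ m) (htn : t < n) (ω : Ω)
    (hY : (Kbr m a f X n k t ω : ℝ) - Tthr f j * ((n : ℝ) - t) ≤ -1) :
    Wf m a f X n k η j (t + 1) ω ≤ (1 + η * (1 - Tthr f j) + η ^ 2) * Wf m a f X n k η j t ω
      - η * (Wf m a f X n k η j t ω *
        ({ω | ∃ l ∈ Icc j m, X t ω = a l}.indicator (fun _ => (1 : ℝ)) ω)) := by
  set E := {ω | ∃ l ∈ Icc j m, X t ω = a l} with hE
  have hT0 := Tthr_nonneg hM.hf_pos j hjm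
  have hT1 := Tthr_le_one hM.hf_pos hM.hf_sum j hjm
  set y := (Kbr m a f X n k t ω : ℝ) - Tthr f j * ((n : ℝ) - t) with hy
  set d := -((Kbr m a f X n k (t + 1) ω : ℝ) - Kbr m a f X n k t ω + Tthr f j) with hd
  have hyd : (Kbr m a f X n k (t + 1) ω : ℝ) - Tthr f j * ((n : ℝ) - ((t + 1 : ℕ) : ℝ)) = y - d := by
    rw [hy, hd]; push_cast; ring
  have hstep : (Kbr m a f X n k (t + 1) ω : ℝ) = Kbr m a f X n k t ω ∨
      (Kbr m a f X n k (t + 1) ω : ℝ) + 1 = Kbr m a f X n k t ω := by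
    rcases K_step (m := m) (a := a) (f := f) X n k t ω with h | h
    · left; rw [h]
    · right; exact_mod_cast h
  have hd1 : |d| ≤ 1 := by
    rw [abs_le]
    rcases hstep with h | h <;> constructor <;> linarith
  have hd2 : d ≤ 1 - Tthr f j - E.indicator (fun _ => (1 : ℝ)) ω := by
    by_cases hω : ω ∈ E
    · have h := K_step_down X n k hM.ha_anti hM.hf_pos ω htn hj hjm hY hω
      have h' : (Kbr m a f X n k (t + 1) ω : ℝ) = Kbr m a f X n k t ω := by exact_mod_cast h
      rw [Set.indicator_of_mem hω]
      linarith
    · rw [Set.indicator_of_notMem hω]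
      rcases hstep with h | h <;> linarith
  have key := exp_bound h0 h1 hd1 hd2
  have e1 : Wf m a f X n k η j (t + 1) ω = Wf m a f X n k η j t ω * Real.exp (η * d) := by
    unfold Wf
    rw [hyd, ← hy, ← Real.exp_add, abs_of_nonpos (by linarith [(abs_le.mp hd1).1]),
      abs_of_nonpos (by linarith)]
    ring_nf
  rw [e1]
  have := mul_le_mul_of_nonneg_left key (Wf_pos m a f X n k η j t ω).le
  linarith

lemma Wf_mid (hM : Model μ m a f X U) (n k : ℕ) {η : ℝ} (h0 : 0 < η)
    {j t : ℕ} (hjm : j ≤ m) (ω : Ω)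
    (hY : |(Kbr m a f X n k t ω : ℝ) - Tthr f j * ((n : ℝ) - t)| ≤ 1) :
    Wf m a f X n k η j (t + 1) ω ≤ Real.exp (2 * η) := by
  have hT0 := Tthr_nonneg hM.hf_pos j hjm
  have hT1 := Tthr_le_one hM.hf_pos hM.hf_sum j hjm
  have hstep : (Kbr m a f X n k (t + 1) ω : ℝ) = Kbr m a f X n k t ω ∨
      (Kbr m a f X n k (t + 1) ω : ℝ) + 1 = Kbr m a f X n k t ω := by
    rcases K_step (m := m) (a := a) (f := f) X n k t ω with h | h
    · left; rw [h]
    · right; exact_mod_cast h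
  unfold Wf
  apply Real.exp_le_exp.mpr
  rw [mul_comm]
  apply mul_le_mul_of_nonneg_right _ h0.le
  rw [abs_le] at hY ⊢
  push_cast
  rcases hstep with h | h <;> constructor <;> linarith

/-- One-step drift with contraction `ρ = exp (-ηδ)`. -/
lemma drift_step (hM : Model μ m a f X U) (n k : ℕ) {η δ ε : ℝ} (h0 : 0 < η) (h1 : η ≤ 1)
    (hε : ∀ j, 1 ≤ j → j ≤ m → ε ≤ f j / 2) (hηδ : η + δ ≤ ε)
    {j t : ℕ} (hj : 1 ≤ j) (hjm : j ≤ m) (htn : t < n)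
    (S : Set Ω) (hS : MeasurableSet[Fil X U t] S) :
    ∫ ω in S, Wf m a f X n k η j (t + 1) ω ∂μ ≤
      Real.exp (-(η * δ)) * ∫ ω in S, Wf m a f X n k η j t ω ∂μ +
        Real.exp (2 * η) * μ.real S := by
  have := hM.hprob
  have hle := Fil_le X U hM.hXmeas hM.hUmeas t
  set Yt : Ω → ℝ := fun ω => (Kbr m a f X n k t ω : ℝ) - Tthr f j * ((n : ℝ) - t) with hYt
  have hYm : Measurable[Fil X U t] Yt := by
    have h : Measurable (fun x : ℕ => (x : ℝ) - Tthr f j * ((n : ℝ) - t)) := measurable_from_nat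
    exact h.comp (K_meas m a f X U n k t)
  set A := S ∩ {ω | 1 ≤ Yt ω} with hA
  set B := S ∩ {ω | Yt ω ≤ -1} with hB
  set C := S \ (A ∪ B) with hC
  have hAm : MeasurableSet[Fil X U t] A := hS.inter (hYm measurableSet_Ici)
  have hBm : MeasurableSet[Fil X U t] B := hS.inter (hYm measurableSet_Iic)
  have hCm : MeasurableSet[Fil X U t] C := hS.diff (hAm.union hBm)
  have hAB : Disjoint A B := by
    rw [Set.disjoint_left]
    rintro ω ⟨-, h⟩ ⟨-, h'⟩
    have h2 : 1 ≤ Yt ω := h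
    have h3 : Yt ω ≤ -1 := h'
    linarith
  have hABC : Disjoint (A ∪ B) C := Set.disjoint_sdiff_right
  have hSe : S = (A ∪ B) ∪ C := by
    rw [hC, Set.union_sdiff_cancel]
    exact Set.union_subset Set.inter_subset_left Set.inter_subset_left
  have hI : ∀ s (D : Set Ω), IntegrableOn (Wf m a f X n k η j s) D μ := fun s D =>
    (Wf_int hM n k h0 j s).integrableOn
  have hIE : ∀ (s : Finset ℕ) (D : Set Ω), IntegrableOn (fun ω => Wf m a f X n k η j t ω *
        ({ω | ∃ l ∈ s, X t ω = a l}.indicator (fun _ => (1 : ℝ)) ω)) D μ := by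
    intro s D
    apply Integrable.integrableOn
    apply (Wf_int hM n k h0 j t).mul_bdd (c := 1)
    · apply Measurable.aestronglyMeasurable
      apply measurable_const.indicator
      have : {ω | ∃ l ∈ s, X t ω = a l} = X t ⁻¹' (a '' s) := by
        ext ω
        simp only [Set.mem_preimage, Set.mem_image, Set.mem_ofPred_eq, Finset.mem_coe, eq_comm]
      rw [this]
      exact hM.hXmeas t (s.finite_toSet.image a).measurableSet
    · refine Filter.Eventually.of_forall fun ω => ?_
      by_cases h : ω ∈ {ω | ∃ l ∈ s, X t ω = a l}
      · rw [Set.indicator_of_mem h]; simp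
      · rw [Set.indicator_of_notMem h]; simp
  have hWnn : ∀ s (D : Set Ω), 0 ≤ ∫ ω in D, Wf m a f X n k η j s ω ∂μ := fun s D =>
    integral_nonneg fun ω => (Wf_pos _ _ _ _ _ _ _ _ _ _).le
  have hρ : 1 - η * ε + η ^ 2 ≤ Real.exp (-(η * δ)) := by
    have := Real.add_one_le_exp (-(η * δ))
    nlinarith
  -- the upper part
  have iA : ∫ ω in A, Wf m a f X n k η j (t + 1) ω ∂μ ≤
      Real.exp (-(η * δ)) * ∫ ω in A, Wf m a f X n k η j t ω ∂μ := by
    have h2 := setIntegral_mono_on (hI (t + 1) A)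
      (((hI t A).const_mul (1 + η * Tthr f j + η ^ 2)).sub ((hIE (Icc 1 j) A).const_mul η))
      (hle _ hAm) (fun ω hω => Wf_up hM n k h0 h1 hj hjm htn ω hω.2)
    simp only [Pi.sub_apply] at h2
    rw [integral_sub ((hI t A).const_mul _) ((hIE (Icc 1 j) A).const_mul η),
      integral_const_mul, integral_const_mul,
      setIntegral_indep hM t (Icc 1 j) (Finset.Icc_subset_Icc le_rfl hjm) A hAm _
        (Wf_meas m a f X U n k η j t)] at h2
    refine h2.trans ?_
    have h3 := Tthr_drift_up hM.hf_pos j hj hjm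
    have h4 := hε j hj hjm
    have h5 : Fbar f (j + 1) = ∑ l ∈ Icc 1 j, f l := by simp [Fbar]
    have h6 : 1 + η * Tthr f j + η ^ 2 - η * ∑ l ∈ Icc 1 j, f l ≤ Real.exp (-(η * δ)) := by
      refine le_trans ?_ hρ
      rw [← h5]; nlinarith
    have := mul_le_mul_of_nonneg_right h6 (hWnn t A)
    linarith
  have iB : ∫ ω in B, Wf m a f X n k η j (t + 1) ω ∂μ ≤
      Real.exp (-(η * δ)) * ∫ ω in B, Wf m a f X n k η j t ω ∂μ := by
    by_cases hj1 : j = 1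
    · have : B = ∅ := by
        rw [Set.eq_empty_iff_forall_notMem]
        rintro ω ⟨-, h⟩
        have h2 : Yt ω ≤ -1 := h
        have h3 : Yt ω = (Kbr m a f X n k t ω : ℝ) := by simp [hYt, Tthr, hj1]
        have : (0 : ℝ) ≤ Kbr m a f X n k t ω := Nat.cast_nonneg _
        linarith
      simp [this]
    have h2 := setIntegral_mono_on (hI (t + 1) B)
      (((hI t B).const_mul (1 + η * (1 - Tthr f j) + η ^ 2)).sub ((hIE (Icc j m) B).const_mul η))
      (hle _ hBm) (fun ω hω => Wf_down hM n k h0 h1 hj hjm htn ω hω.2)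
    simp only [Pi.sub_apply] at h2
    rw [integral_sub ((hI t B).const_mul _) ((hIE (Icc j m) B).const_mul η),
      integral_const_mul, integral_const_mul,
      setIntegral_indep hM t (Icc j m) (Finset.Icc_subset_Icc hj le_rfl) B hBm _
        (Wf_meas m a f X U n k η j t), sum_tail hM.hf_sum j hj hjm] at h2
    refine h2.trans ?_
    have h3 := Tthr_drift_down (f := f) j (by omega)
    have h4 := hε j hj hjm
    have h6 : 1 + η * (1 - Tthr f j) + η ^ 2 - η * (1 - Fbar f j) ≤ Real.exp (-(η * δ)) := by
      refine le_trans ?_ hρ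
      nlinarith
    have := mul_le_mul_of_nonneg_right h6 (hWnn t B)
    linarith
  have iC : ∫ ω in C, Wf m a f X n k η j (t + 1) ω ∂μ ≤ Real.exp (2 * η) * μ.real S := by
    have h2 := setIntegral_mono_on (hI (t + 1) C)
      (integrableOn_const (C := Real.exp (2 * η)) (s := C) (by finiteness))
      (hle _ hCm) (fun ω hω => by
        apply Wf_mid hM n k h0 hjm ω
        have hωS : ω ∈ S := hω.1
        have hn1 : ¬ 1 ≤ Yt ω := fun h => hω.2 (Or.inl ⟨hωS, h⟩)
        have hn2 : ¬ Yt ω ≤ -1 := fun h => hω.2 (Or.inr ⟨hωS, h⟩)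
        rw [abs_le]
        constructor
        · exact (not_le.mp hn2).le
        · exact (not_le.mp hn1).le)
    refine h2.trans ?_
    rw [setIntegral_const, smul_eq_mul, mul_comm]
    apply mul_le_mul_of_nonneg_left _ (Real.exp_pos _).le
    exact measureReal_mono Set.sdiff_subset
  have sp : ∀ s, ∫ ω in S, Wf m a f X n k η j s ω ∂μ = ∫ ω in A, Wf m a f X n k η j s ω ∂μ +
      ∫ ω in B, Wf m a f X n k η j s ω ∂μ + ∫ ω in C, Wf m a f X n k η j s ω ∂μ := by
    intro s
    conv_lhs => rw [hSe]
    rw [setIntegral_union hABC (hle _ hCm) (hI s _) (hI s _),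
      setIntegral_union hAB (hle _ hBm) (hI s _) (hI s _)]
  rw [sp (t + 1), sp t]
  have := mul_nonneg (Real.exp_pos (-(η * δ))).le (hWnn t C)
  linarith

lemma drift_iter (hM : Model μ m a f X U) (n k : ℕ) {η δ ε : ℝ} (h0 : 0 < η) (h1 : η ≤ 1)
    (hδ : 0 < δ)
    (hε : ∀ j, 1 ≤ j → j ≤ m → ε ≤ f j / 2) (hηδ : η + δ ≤ ε)
    {j r : ℕ} (hj : 1 ≤ j) (hjm : j ≤ m)
    (S : Set Ω) (hS : MeasurableSet[Fil X U r] S) (u : ℕ) (hu : r + u ≤ n) :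
    ∫ ω in S, Wf m a f X n k η j (r + u) ω ∂μ ≤
      Real.exp (-(η * δ) * u) * ∫ ω in S, Wf m a f X n k η j r ω ∂μ +
        Real.exp (2 * η) / (1 - Real.exp (-(η * δ))) * μ.real S := by
  have hρ : Real.exp (-(η * δ)) < 1 := by
    rw [Real.exp_lt_one_iff]
    have := mul_pos h0 hδ
    linarith
  have hρ' : 0 < 1 - Real.exp (-(η * δ)) := by linarith
  induction u with
  | zero =>
    have : 0 ≤ Real.exp (2 * η) / (1 - Real.exp (-(η * δ))) * μ.real S := by positivity
    simpa using this
  | succ u ih =>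
    have ih := ih (by omega)
    have h := drift_step hM n k h0 h1 hε hηδ hj hjm (t := r + u) (by omega) S
      (Fil_mono X U (by omega) _ hS)
    rw [← add_assoc]
    refine h.trans ?_
    have h2 := mul_le_mul_of_nonneg_left ih (Real.exp_pos (-(η * δ))).le
    have h3 : Real.exp (-(η * δ) * ((u + 1 : ℕ) : ℝ)) =
        Real.exp (-(η * δ)) * Real.exp (-(η * δ) * u) := by
      rw [← Real.exp_add]; push_cast; ring_nf
    rw [h3]
    have h4 : Real.exp (-(η * δ)) * (Real.exp (2 * η) / (1 - Real.exp (-(η * δ))) * μ.real S) +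
        Real.exp (2 * η) * μ.real S =
        Real.exp (2 * η) / (1 - Real.exp (-(η * δ))) * μ.real S := by
      field_simp
      ring
    linarith

/-- The Markov inequality applied to the Lyapunov function. -/
lemma tail_on (hM : Model μ m a f X U) (n k : ℕ) {η δ ε : ℝ} (h0 : 0 < η) (h1 : η ≤ 1)
    (hδ : 0 < δ)
    (hε : ∀ j, 1 ≤ j → j ≤ m → ε ≤ f j / 2) (hηδ : η + δ ≤ ε)
    {j r : ℕ} (hj : 1 ≤ j) (hjm : j ≤ m)
    (S : Set Ω) (hS : MeasurableSet[Fil X U r] S) (u : ℕ) (hu : r + u ≤ n)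
    (hini : ∀ ω ∈ S, |(Kbr m a f X n k r ω : ℝ) - Tthr f j * ((n : ℝ) - r)| ≤
      δ / 2 * ((n : ℝ) - r)) :
    μ.real (S ∩ {ω | δ * ((n : ℝ) - r - u) ≤
        |(Kbr m a f X n k (r + u) ω : ℝ) - Tthr f j * ((n : ℝ) - r - u)|}) ≤
      (Real.exp (-(η * δ / 2) * ((n : ℝ) - r)) +
        Real.exp (2 * η) / (1 - Real.exp (-(η * δ))) *
          Real.exp (-(η * δ) * ((n : ℝ) - r - u))) * μ.real S := by
  have := hM.hprob
  have hle := Fil_le X U hM.hXmeas hM.hUmeas r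
  have hSm := hle _ hS
  have hit := drift_iter hM n k h0 h1 hδ hε hηδ hj hjm S hS u hu
  have hb : ∫ ω in S, Wf m a f X n k η j r ω ∂μ ≤
      Real.exp (η * δ / 2 * ((n : ℝ) - r)) * μ.real S := by
    have h2 := setIntegral_mono_on ((Wf_int hM n k h0 j r).integrableOn (s := S))
      (integrableOn_const (C := Real.exp (η * δ / 2 * ((n : ℝ) - r))) (s := S) (by finiteness))
      hSm (fun ω hω => by
        unfold Wf
        apply Real.exp_le_exp.mpr
        have := mul_le_mul_of_nonneg_left (hini ω hω) h0.le
        linarith)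
    refine h2.trans ?_
    rw [setIntegral_const, smul_eq_mul, mul_comm]
  set D := {ω | δ * ((n : ℝ) - r - u) ≤
        |(Kbr m a f X n k (r + u) ω : ℝ) - Tthr f j * ((n : ℝ) - r - u)|} with hD
  set e := Real.exp (η * δ * ((n : ℝ) - r - u)) with he
  have hmk := mul_meas_ge_le_integral_of_nonneg (μ := μ.restrict S)
    (f := Wf m a f X n k η j (r + u))
    (Filter.Eventually.of_forall fun ω => (Wf_pos _ _ _ _ _ _ _ _ _ _).le)
    (Wf_int hM n k h0 j (r + u)).integrableOn e
  have hm2 : μ.real (S ∩ D) ≤ (μ.restrict S).real {x | e ≤ Wf m a f X n k η j (r + u) x} := by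
    rw [measureReal_restrict_apply' hSm]
    refine measureReal_mono ?_ (measure_ne_top _ _)
    rintro ω ⟨hω, hωD⟩
    refine ⟨?_, hω⟩
    change e ≤ _
    rw [he]
    unfold Wf
    apply Real.exp_le_exp.mpr
    have h3 : δ * ((n : ℝ) - r - u) ≤
        |(Kbr m a f X n k (r + u) ω : ℝ) - Tthr f j * ((n : ℝ) - r - u)| := hωD
    have h4 := mul_le_mul_of_nonneg_left h3 h0.le
    rw [show (n : ℝ) - ((r + u : ℕ) : ℝ) = (n : ℝ) - r - u by push_cast; ring]
    linarith
  have he0 : 0 < e := Real.exp_pos _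
  have h5 : e * μ.real (S ∩ D) ≤ Real.exp (-(η * δ) * u) *
      (Real.exp (η * δ / 2 * ((n : ℝ) - r)) * μ.real S) +
        Real.exp (2 * η) / (1 - Real.exp (-(η * δ))) * μ.real S := by
    have := mul_le_mul_of_nonneg_left hm2 he0.le
    have h6 := mul_le_mul_of_nonneg_left hb (Real.exp_pos (-(η * δ) * u)).le
    linarith
  rw [← mul_le_mul_iff_right₀ he0]
  refine h5.trans (le_of_eq ?_)
  have e1 : Real.exp (-(η * δ) * u) * Real.exp (η * δ / 2 * ((n : ℝ) - r)) =
      e * Real.exp (-(η * δ / 2) * ((n : ℝ) - r)) := by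
    rw [he, ← Real.exp_add, ← Real.exp_add]; ring_nf
  have e2 : e * Real.exp (-(η * δ) * ((n : ℝ) - r - u)) = 1 := by
    rw [he, ← Real.exp_add, ← Real.exp_zero]; ring_nf
  rw [← mul_assoc, e1]
  linear_combination (-(Real.exp (2 * η) / (1 - Real.exp (-(η * δ))) * μ.real S)) * e2

end drift

/-! ### The stopping time -/

lemma tau0_spec (m : ℕ) (f : ℕ → ℝ) {δ : ℝ} (hδ : 0 < δ) (K : ℕ → Ω → ℕ) (n : ℕ) (ω : Ω) :
    (∃ j ∈ Icc 1 m, |ratio K n (tau0 m f δ K n ω) ω - Tthr f j| ≤ δ / 2) ∨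
      (n : ℝ) - 2 / δ - 1 ≤ (tau0 m f δ K n ω : ℝ) := by
  have hne : {t : ℕ | (∃ j ∈ Icc 1 m, |ratio K n t ω - Tthr f j| ≤ δ / 2) ∨
      (n : ℝ) - 2 / δ - 1 ≤ (t : ℝ)}.Nonempty := by
    refine ⟨n, Or.inr ?_⟩
    have : 0 < 2 / δ := by positivity
    linarith
  exact Nat.sInf_mem hne

lemma tau0_eq_iff (m : ℕ) (f : ℕ → ℝ) {δ : ℝ} (hδ : 0 < δ) (K : ℕ → Ω → ℕ) (n r : ℕ) (ω : Ω) :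
    tau0 m f δ K n ω = r ↔
      ((∃ j ∈ Icc 1 m, |ratio K n r ω - Tthr f j| ≤ δ / 2) ∨ (n : ℝ) - 2 / δ - 1 ≤ (r : ℝ)) ∧
      ∀ s ∈ Finset.range r,
        ¬ ((∃ j ∈ Icc 1 m, |ratio K n s ω - Tthr f j| ≤ δ / 2) ∨
          (n : ℝ) - 2 / δ - 1 ≤ (s : ℝ)) := by
  constructor
  · rintro rfl
    refine ⟨tau0_spec m f hδ K n ω, ?_⟩
    intro s hs h
    rw [Finset.mem_range] at hs
    exact Nat.notMem_of_lt_sInf hs h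
  · rintro ⟨h1, h2⟩
    apply le_antisymm
    · exact Nat.sInf_le h1
    · by_contra hc
      exact h2 _ (Finset.mem_range.mpr (not_le.mp hc)) (tau0_spec m f hδ K n ω)

lemma jTau0_spec (m : ℕ) (f : ℕ → ℝ) {δ : ℝ} (hδ : 0 < δ) (K : ℕ → Ω → ℕ) (n : ℕ) (ω : Ω)
    (h : (tau0 m f δ K n ω : ℝ) < (n : ℝ) - 2 / δ - 1) :
    jTau0 m f δ K n ω ∈ Icc 1 m ∧
      |ratio K n (tau0 m f δ K n ω) ω - Tthr f (jTau0 m f δ K n ω)| ≤ δ / 2 := by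
  rcases tau0_spec m f hδ K n ω with h1 | h1
  · obtain ⟨j, hj⟩ := h1
    have hne : {j : ℕ | j ∈ Icc 1 m ∧
      |ratio K n (tau0 m f δ K n ω) ω - Tthr f j| ≤ δ / 2}.Nonempty := ⟨j, hj⟩
    have := Nat.sInf_mem hne
    unfold jTau0
    rw [if_pos h]
    exact this
  · linarith

lemma B_meas (m : ℕ) (a f : ℕ → ℝ) (X U : ℕ → Ω → ℝ) (n k : ℕ) {δ : ℝ} (hδ : 0 < δ) (r j : ℕ) :
    MeasurableSet[Fil X U r] {ω | tau0 m f δ (Kbr m a f X n k) n ω = r ∧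
      jTau0 m f δ (Kbr m a f X n k) n ω = j} := by
  set K := Kbr m a f X n k with hK
  have hP : ∀ s, MeasurableSet[Fil X U s]
      {ω | (∃ j ∈ Icc 1 m, |ratio K n s ω - Tthr f j| ≤ δ / 2) ∨
        (n : ℝ) - 2 / δ - 1 ≤ (s : ℝ)} := by
    intro s
    exact K_meas m a f X U n k s (MeasurableSet.of_discrete (s := {x : ℕ |
      (∃ j ∈ Icc 1 m, |(x : ℝ) / ((n : ℝ) - s) - Tthr f j| ≤ δ / 2) ∨
        (n : ℝ) - 2 / δ - 1 ≤ (s : ℝ)}))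
  have hJ : MeasurableSet[Fil X U r] (K r ⁻¹' {x : ℕ |
      (if (r : ℝ) < (n : ℝ) - 2 / δ - 1 then
        sInf {j : ℕ | j ∈ Icc 1 m ∧ |(x : ℝ) / ((n : ℝ) - r) - Tthr f j| ≤ δ / 2}
        else m + 1) = j}) :=
    K_meas m a f X U n k r MeasurableSet.of_discrete
  have e : {ω | tau0 m f δ K n ω = r ∧ jTau0 m f δ K n ω = j} =
      ({ω | (∃ j ∈ Icc 1 m, |ratio K n r ω - Tthr f j| ≤ δ / 2) ∨
        (n : ℝ) - 2 / δ - 1 ≤ (r : ℝ)} ∩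
        ⋂ s ∈ Finset.range r, {ω | (∃ j ∈ Icc 1 m, |ratio K n s ω - Tthr f j| ≤ δ / 2) ∨
        (n : ℝ) - 2 / δ - 1 ≤ (s : ℝ)}ᶜ) ∩
      (K r ⁻¹' {x : ℕ |
      (if (r : ℝ) < (n : ℝ) - 2 / δ - 1 then
        sInf {j : ℕ | j ∈ Icc 1 m ∧ |(x : ℝ) / ((n : ℝ) - r) - Tthr f j| ≤ δ / 2}
        else m + 1) = j}) := by
    ext ω
    have h1 := tau0_eq_iff m f hδ K n r ω
    constructor
    · rintro ⟨h, h'⟩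
      have h2 := h1.mp h
      refine ⟨⟨h2.1, ?_⟩, ?_⟩
      · simp only [Set.mem_iInter]
        intro s hs
        exact h2.2 s hs
      · change _ = j
        rw [← h', jTau0, h]
        rfl
    · rintro ⟨⟨h2, h3⟩, h4⟩
      simp only [Set.mem_iInter] at h3
      have h := h1.mpr ⟨h2, fun s hs => h3 s hs⟩
      refine ⟨h, ?_⟩
      rw [jTau0, h]
      exact h4
  rw [e]
  refine ((hP r).inter ?_).inter hJ
  refine Finset.measurableSet_biInter _ ?_
  intro s hs
  rw [Finset.mem_range] at hs
  exact (Fil_mono X U hs.le _ (hP s)).compl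

lemma main_aux {Ω : Type*} (mτ : MeasurableSpace Ω) [m0 : MeasurableSpace Ω] (μ : Measure Ω)
    (ε δ η : ℝ) (hδ0 : 0 < δ) (hη0 : 0 < η) (hηδ : η + δ ≤ ε)
    (hρ' : 0 < 1 - Real.exp (-(η * δ)))
    (m : ℕ) (a f : ℕ → ℝ) (X U : ℕ → Ω → ℝ)
    (hM : Model μ m a f X U) (hεm : ε = minf m f / 2) (n k : ℕ)
    (K : ℕ → Ω → ℕ) (hK : K = Kbr m a f X n k)
    (τ₀ : Ω → ℕ) (hτ : τ₀ = tau0 m f δ K n)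
    (Y : ℕ → Ω → ℝ) (hY : Y = Ydev m f δ K n)
    (hmτ : ∀ s : Set Ω, MeasurableSet[mτ] s ↔
      ∀ t : ℕ, MeasurableSet[Fil X U t] (s ∩ {ω | τ₀ ω ≤ t})) (u : ℕ) :
    ∀ᵐ ω ∂μ,
                    (u ≤ n - τ₀ ω ∧ (τ₀ ω : ℝ) < (n : ℝ) - 2 / δ - 1) →
                      (μ[Set.indicator
                            {ω' | δ * ((n : ℝ) - (τ₀ ω' : ℝ) - (u : ℝ)) ≤ |Y u ω'|}
                            (fun _ => (1 : ℝ)) | mτ]) ω ≤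
                        2 * Real.exp (-(η * δ / 2) * ((n : ℝ) - (τ₀ ω : ℝ))) +
                          Real.exp (2 * η) / (1 - Real.exp (-(η * δ))) * Real.exp (-(η * δ) * ((n : ℝ) - (τ₀ ω : ℝ) - (u : ℝ))) := by
  have := hM.hprob
  have hε : ∀ j, 1 ≤ j → j ≤ m → ε ≤ f j / 2 := by
    intro j hj hjm
    have : minf m f ≤ f j := by
      apply csInf_le
      · refine ⟨0, ?_⟩
        rintro x ⟨i, hi, him, rfl⟩
        exact (hM.hf_pos i hi him).le
      · exact ⟨j, hj, hjm, rfl⟩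
    linarith
  have hη1 : η ≤ 1 := by
    have h1 := hε 1 le_rfl hM.hm
    have h2 := Fbar_le_one hM.hf_pos hM.hf_sum 2 (by have := hM.hm; omega)
    have h3 : Fbar f 2 = f 1 := by simp [Fbar]
    linarith
  have hle := Fil_le X U hM.hXmeas hM.hUmeas
  have hmle : mτ ≤ m0 := by
    intro s hs
    have h := (hmτ s).mp hs
    have e : s = ⋃ t : ℕ, s ∩ {ω | τ₀ ω ≤ t} := by
      ext ω
      simp only [Set.mem_iUnion, Set.mem_inter_iff, Set.mem_ofPred_eq]
      exact ⟨fun h => ⟨τ₀ ω, h, le_rfl⟩, fun ⟨_, h, _⟩ => h⟩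
    rw [e]
    exact MeasurableSet.iUnion fun t => hle t _ (h t)
  set D' := {ω' | δ * ((n : ℝ) - (τ₀ ω' : ℝ) - (u : ℝ)) ≤ |Y u ω'|} with hD'
  set g := μ[Set.indicator D' (fun _ => (1 : ℝ)) | mτ] with hg
  by_cases hIntD : Integrable (Set.indicator D' (fun _ => (1 : ℝ))) μ
  swap
  · rw [hg, condExp_of_not_integrable hIntD]
    refine Filter.Eventually.of_forall fun ω _ => ?_
    simp only [Pi.zero_apply]
    positivity
  have hred : ∀ r j : ℕ, ∀ᵐ ω ∂μ, (τ₀ ω = r ∧ jTau0 m f δ K n ω = j) →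
      (u ≤ n - r ∧ (r : ℝ) < (n : ℝ) - 2 / δ - 1) →
      g ω ≤ 2 * Real.exp (-(η * δ / 2) * ((n : ℝ) - (r : ℝ))) +
        Real.exp (2 * η) / (1 - Real.exp (-(η * δ))) *
          Real.exp (-(η * δ) * ((n : ℝ) - (r : ℝ) - (u : ℝ))) := by
    intro r j
    by_cases hc : u ≤ n - r ∧ (r : ℝ) < (n : ℝ) - 2 / δ - 1
    swap
    · exact Filter.Eventually.of_forall fun ω _ h => absurd h hc
    obtain ⟨hur, hrn⟩ := hc
    have h2δ : 0 < 2 / δ := by positivity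
    have hrn' : r < n := by
      have : (r : ℝ) < n := by linarith
      exact_mod_cast this
    have hnr : (0 : ℝ) < (n : ℝ) - r := by linarith
    by_cases hjm : j ∈ Icc 1 m
    swap
    · refine Filter.Eventually.of_forall ?_
      rintro ω ⟨h1, h2⟩ _
      rw [hτ] at h1
      exact absurd (h2 ▸ (jTau0_spec m f hδ0 K n ω (by rw [h1]; exact hrn)).1) hjm
    rw [Finset.mem_Icc] at hjm
    set b := 2 * Real.exp (-(η * δ / 2) * ((n : ℝ) - (r : ℝ))) +
        Real.exp (2 * η) / (1 - Real.exp (-(η * δ))) *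
          Real.exp (-(η * δ) * ((n : ℝ) - (r : ℝ) - (u : ℝ))) with hb
    have hb0 : 0 ≤ b := by positivity
    set B := {ω | τ₀ ω = r ∧ jTau0 m f δ K n ω = j} with hB
    have hBF : MeasurableSet[Fil X U r] B := by
      have := B_meas m a f X U n k hδ0 r j
      rw [hB, hτ, hK]
      exact this
    have hBτ : MeasurableSet[mτ] B := by
      rw [hmτ]
      intro t
      by_cases hrt : r ≤ t
      · have : B ∩ {ω | τ₀ ω ≤ t} = B := by
          rw [Set.inter_eq_left]
          rintro ω ⟨h, -⟩
          change τ₀ ω ≤ t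
          omega
        rw [this]
        exact Fil_mono X U hrt _ hBF
      · have : B ∩ {ω | τ₀ ω ≤ t} = ∅ := by
          rw [Set.eq_empty_iff_forall_notMem]
          rintro ω ⟨⟨h, -⟩, h'⟩
          have : τ₀ ω ≤ t := h'
          omega
        rw [this]
        exact @MeasurableSet.empty _ (Fil X U t)
    have hgm : Measurable[mτ] g := stronglyMeasurable_condExp.measurable
    have hGτ : MeasurableSet[mτ] {ω | b < g ω} := hgm measurableSet_Ioi
    set N := {ω | b < g ω} ∩ B with hN
    have hNτ : MeasurableSet[mτ] N := hGτ.inter hBτ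
    have hNF : MeasurableSet[Fil X U r] N := by
      have h := (hmτ N).mp hNτ r
      have e : N ∩ {ω | τ₀ ω ≤ r} = N := by
        rw [Set.inter_eq_left]
        rintro ω ⟨-, h, -⟩
        exact h.le
      rwa [e] at h
    have hNm := hmle _ hNτ
    -- the conditional probability integrated over `N`
    set D := {ω | δ * ((n : ℝ) - r - u) ≤
        |(Kbr m a f X n k (r + u) ω : ℝ) - Tthr f j * ((n : ℝ) - r - u)|} with hD
    have hDm : MeasurableSet D := by
      apply hle (r + u)
      exact K_meas m a f X U n k (r + u) (MeasurableSet.of_discrete (s := {x : ℕ |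
        δ * ((n : ℝ) - r - u) ≤ |(x : ℝ) - Tthr f j * ((n : ℝ) - r - u)|}))
    have hI : ∫ ω in N, g ω ∂μ = μ.real (N ∩ D) := by
      rw [hg, setIntegral_condExp hmle hIntD hNτ]
      have : ∫ ω in N, D'.indicator (fun _ => (1 : ℝ)) ω ∂μ =
          ∫ ω in N, D.indicator 1 ω ∂μ := by
        apply setIntegral_congr_fun hNm
        rintro ω ⟨-, h1, h2⟩
        have hiff : ω ∈ D' ↔ ω ∈ D := by
          rw [hτ] at h1
          simp only [hD', hD, Set.mem_ofPred_eq, hY, Ydev, hτ]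
          rw [h1, h2, hK]
        by_cases hω : ω ∈ D
        · simp [hω, hiff.mpr hω]
        · have : ω ∉ D' := fun h => hω (hiff.mp h)
          simp [hω, this]
      rw [this, integral_indicator_one hDm, measureReal_restrict_apply hDm, Set.inter_comm]
    have htail := tail_on hM n k hη0 hη1 hδ0 hε hηδ hjm.1 hjm.2 N hNF u (by omega) (by
      rintro ω ⟨-, h1, h2⟩
      rw [hτ] at h1
      have h3 := (jTau0_spec m f hδ0 K n ω (by rw [h1]; exact hrn)).2
      rw [h1, h2, ratio, hK] at h3
      have e : (Kbr m a f X n k r ω : ℝ) - Tthr f j * ((n : ℝ) - r) =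
          ((Kbr m a f X n k r ω : ℝ) / ((n : ℝ) - r) - Tthr f j) * ((n : ℝ) - r) := by
        field_simp
      rw [e, abs_mul, abs_of_pos hnr]
      exact mul_le_mul_of_nonneg_right h3 hnr.le)
    have hN0 : μ N = 0 := by
      by_contra hne
      have hpos := setIntegral_gt_gt (μ := μ.restrict B) hb0
        (integrable_condExp (m := mτ) (f := D'.indicator (fun _ => (1 : ℝ)))).integrableOn.integrableOn
        (by
          change (μ.restrict B) {ω | b < g ω} ≠ 0
          rw [Measure.restrict_apply (hmle _ hGτ)]
          exact hne)
      change (μ.restrict B).real {ω | b < g ω} * b <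
        ∫ ω in {ω | b < g ω}, g ω ∂(μ.restrict B) at hpos
      rw [Measure.restrict_restrict (hmle _ hGτ),
        measureReal_restrict_apply (hmle _ hGτ), ← hN, hI] at hpos
      have hNn : 0 ≤ μ.real N := measureReal_nonneg
      have hee : 0 ≤ Real.exp (-(η * δ / 2) * ((n : ℝ) - (r : ℝ))) * μ.real N := by positivity
      rw [hb] at hpos
      linarith
    filter_upwards [measure_eq_zero_iff_ae_notMem.mp hN0] with ω hω hωB _
    by_contra hc
    exact hω ⟨not_le.mp hc, hωB⟩
  have hall : ∀ᵐ ω ∂μ, ∀ r j : ℕ, (τ₀ ω = r ∧ jTau0 m f δ K n ω = j) →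
      (u ≤ n - r ∧ (r : ℝ) < (n : ℝ) - 2 / δ - 1) →
      g ω ≤ 2 * Real.exp (-(η * δ / 2) * ((n : ℝ) - (r : ℝ))) +
        Real.exp (2 * η) / (1 - Real.exp (-(η * δ))) *
          Real.exp (-(η * δ) * ((n : ℝ) - (r : ℝ) - (u : ℝ))) := by
    rw [ae_all_iff]; intro r
    rw [ae_all_iff]; intro j
    exact hred r j
  filter_upwards [hall] with ω hω h
  exact hω (τ₀ ω) _ ⟨rfl, rfl⟩ h

/-- Proposition 6, exponential tail bound: with `c = e² - 3` and
`0 < η < (ε-δ)/c`, there is a constant `M ≡ M(ε, δ, η)` such that for all `(n,k) ∈ 𝒯` and all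
`0 ≤ u ≤ n - τ₀`, almost surely (on the non-trivial event `τ₀ < n - 2δ⁻¹ - 1`),
`P(|Y_u| ≥ δ(n-τ₀-u) | 𝓕̂₀) ≤ 2 exp{-(ηδ/2)(n-τ₀)} + M exp{-ηδ(n-τ₀-u)}`, where
`𝓕̂₀ = 𝓕_{τ₀}` is the σ-field stopped at `τ₀`. -/
theorem budget_ratio_exponential_tail_bound (ε δ η : ℝ) (hδ0 : 0 < δ) (hδε : δ < ε)
    (hη0 : 0 < η) (hη : η < (ε - δ) / (Real.exp 2 - 3)) :
    ∃ M : ℝ,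
      ∀ (Ω : Type) [MeasurableSpace Ω] (μ : Measure Ω)
        (m : ℕ) (a f : ℕ → ℝ) (X U : ℕ → Ω → ℝ),
        Model μ m a f X U → ε = minf m f / 2 →
        ∀ n k : ℕ, k ≤ n →
          ∀ K : ℕ → Ω → ℕ, K = Kbr m a f X n k →
            ∀ τ₀ : Ω → ℕ, τ₀ = tau0 m f δ K n →
              ∀ Y : ℕ → Ω → ℝ, Y = Ydev m f δ K n →
                ∀ mτ : MeasurableSpace Ω,
                  (∀ s : Set Ω, MeasurableSet[mτ] s ↔
                    ∀ t : ℕ, MeasurableSet[Fil X U t] (s ∩ {ω | τ₀ ω ≤ t})) →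
                  ∀ u : ℕ, ∀ᵐ ω ∂μ,
                    (u ≤ n - τ₀ ω ∧ (τ₀ ω : ℝ) < (n : ℝ) - 2 / δ - 1) →
                      (μ[Set.indicator
                            {ω' | δ * ((n : ℝ) - (τ₀ ω' : ℝ) - (u : ℝ)) ≤ |Y u ω'|}
                            (fun _ => (1 : ℝ)) | mτ]) ω ≤
                        2 * Real.exp (-(η * δ / 2) * ((n : ℝ) - (τ₀ ω : ℝ))) +
                          M * Real.exp (-(η * δ) * ((n : ℝ) - (τ₀ ω : ℝ) - (u : ℝ))) := by
  have hexp2 : 4 ≤ Real.exp 2 := by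
    have h1 := Real.exp_one_gt_d9
    have h2 : Real.exp 2 = Real.exp 1 * Real.exp 1 := by rw [← Real.exp_add]; norm_num
    rw [h2]; nlinarith
  have hηδ : η + δ ≤ ε := by
    rw [lt_div_iff₀ (by linarith)] at hη
    nlinarith
  have hρ : Real.exp (-(η * δ)) < 1 := by
    rw [Real.exp_lt_one_iff]
    have := mul_pos hη0 hδ0
    linarith
  have hρ' : 0 < 1 - Real.exp (-(η * δ)) := by linarith
  refine ⟨Real.exp (2 * η) / (1 - Real.exp (-(η * δ))), ?_⟩
  intro Ω inst μ m a f X U hM hεm n k _ K hK τ₀ hτ Y hY mτ hmτ u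
  exact @main_aux Ω mτ inst μ ε δ η hδ0 hη0 hηδ hρ' m a f X U hM hεm n k K hK τ₀ hτ Y hY hmτ u

end MultiSecretary
end
end

section
/- For any ε' ∈ (0,1) and all pairs (n,k) with n ≥ 1, 0 ≤ k ≤ n, and ε' ≤ k/n, the non-adaptive index policy id satisfies V_off^*(n,k) − V_on^{id}(n,k) ≤ DR(n,k) − V_on^{id}(n,k) ≤ (ε')^{−1} a_1 √n. -/
open MeasureTheory ProbabilityTheory Finset

noncomputable section

namespace MultiSecretary

variable {Ω : Type*}

/-- The indicator that candidate `t` has ability `a j` and passes the threshold `p j t`. -/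
def Ind (a : ℕ → ℝ) (p : ℕ → ℕ → ℝ) (X U : ℕ → Ω → ℝ) (j t : ℕ) (ω : Ω) : ℝ :=
  if U t ω ≤ p j t ∧ X t ω = a j then 1 else 0

lemma Zc_nonneg (X : ℕ → Ω → ℝ) (b : ℝ) (r : ℕ) (ω : Ω) : 0 ≤ Zc X b r ω := by
  unfold Zc
  exact Finset.sum_nonneg fun t _ => by split_ifs <;> norm_num

lemma Zc_meas [MeasurableSpace Ω] (X : ℕ → Ω → ℝ) (hX : ∀ t, Measurable (X t)) (b : ℝ) (r : ℕ) :
    Measurable (Zc X b r) := by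
  unfold Zc
  refine Finset.measurable_fun_sum _ fun t _ => ?_
  exact Measurable.ite (hX t (measurableSet_singleton b)) measurable_const measurable_const

lemma Zc_le (X : ℕ → Ω → ℝ) (b : ℝ) (r : ℕ) (ω : Ω) : Zc X b r ω ≤ r := by
  unfold Zc
  calc _ ≤ ∑ t ∈ range r, (1 : ℝ) := Finset.sum_le_sum fun t _ => by split_ifs <;> norm_num
    _ = r := by simp

lemma sum_Icc_pred (g : ℕ → ℝ) (j : ℕ) (hj : 1 ≤ j) :
    ∑ i ∈ Icc 1 j, g i = ∑ i ∈ Icc 1 (j - 1), g i + g j := by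
  obtain ⟨i, rfl⟩ : ∃ i, j = i + 1 := ⟨j - 1, by omega⟩
  rw [Finset.sum_Icc_succ_top (by omega)]; simp

lemma Soff_sum (a : ℕ → ℝ) (X : ℕ → Ω → ℝ) (k r M : ℕ) (ω : Ω) :
    ∑ j ∈ Icc 1 M, Soff a X k r j ω = min (k : ℝ) (∑ j ∈ Icc 1 M, Zc X (a j) r ω) := by
  induction M with
  | zero => simp
  | succ M ih =>
    rw [sum_Icc_pred _ _ (by omega), sum_Icc_pred _ (M + 1) (by omega)]
    simp only [Nat.add_sub_cancel, ih]
    unfold Soff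
    simp only [Nat.add_sub_cancel]
    have := Zc_nonneg X (a (M + 1)) r ω
    generalize (∑ j ∈ Icc 1 M, Zc X (a j) r ω) = S
    generalize Zc X (a (M + 1)) r ω = z at *
    rcases le_total (k : ℝ) S with h | h
    · rw [max_eq_right (by linarith), min_eq_left h, min_eq_right this, min_eq_left (by linarith)]
      ring
    · rw [max_eq_left (by linarith), min_eq_right h]
      rcases le_total z (k - S) with h2 | h2
      · rw [min_eq_left h2, min_eq_right (by linarith)]
      · rw [min_eq_right h2, min_eq_left (by linarith)]; ring

lemma Model.a_anti [MeasurableSpace Ω] {μ : Measure Ω} {m : ℕ} {a f : ℕ → ℝ} {X U : ℕ → Ω → ℝ}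
    (hM : Model μ m a f X U) {i j : ℕ} (hi : 1 ≤ i) (hij : i < j) (hj : j ≤ m) : a j < a i := by
  induction j, hij using Nat.le_induction with
  | base => exact hM.ha_anti i hi (by omega)
  | succ j hij ih =>
    exact (hM.ha_anti j (by omega) (by omega)).trans (ih (by omega))

lemma Model.a_anti_le [MeasurableSpace Ω] {μ : Measure Ω} {m : ℕ} {a f : ℕ → ℝ}
    {X U : ℕ → Ω → ℝ}
    (hM : Model μ m a f X U) {i j : ℕ} (hi : 1 ≤ i) (hij : i ≤ j) (hj : j ≤ m) : a j ≤ a i := by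
  rcases hij.eq_or_lt with rfl | h
  · exact le_rfl
  · exact (hM.a_anti hi h hj).le

lemma Model.a_pos [MeasurableSpace Ω] {μ : Measure Ω} {m : ℕ} {a f : ℕ → ℝ} {X U : ℕ → Ω → ℝ}
    (hM : Model μ m a f X U) {j : ℕ} (hj1 : 1 ≤ j) (hj : j ≤ m) : 0 < a j :=
  hM.ha_pos.trans_le (hM.a_anti_le hj1 hj le_rfl)

lemma Model.a_inj [MeasurableSpace Ω] {μ : Measure Ω} {m : ℕ} {a f : ℕ → ℝ} {X U : ℕ → Ω → ℝ}
    (hM : Model μ m a f X U) {i j : ℕ} (hi : 1 ≤ i) (him : i ≤ m) (hj : 1 ≤ j) (hjm : j ≤ m)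
    (h : a i = a j) : i = j := by
  rcases lt_trichotomy i j with h1 | h1 | h1
  · have := hM.a_anti hi h1 hjm; linarith
  · exact h1
  · have := hM.a_anti hj h1 him; linarith

lemma integral_Zc [MeasurableSpace Ω] {μ : Measure Ω} {m : ℕ} {a f : ℕ → ℝ} {X U : ℕ → Ω → ℝ}
    (hM : Model μ m a f X U) (n j : ℕ) (hj1 : 1 ≤ j) (hj : j ≤ m) :
    ∫ ω, Zc X (a j) n ω ∂μ = n * f j := by
  have := hM.hprob
  have hset : ∀ t, MeasurableSet {ω | X t ω = a j} := fun t =>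
    hM.hXmeas t (measurableSet_singleton (a j))
  have heq : ∀ t, (fun ω => if X t ω = a j then (1 : ℝ) else 0)
      = Set.indicator {ω | X t ω = a j} (fun _ => 1) := by
    intro t; ext ω; simp [Set.indicator_apply]
  unfold Zc
  rw [integral_finsetSum]
  · rw [Finset.sum_congr rfl (g := fun _ => f j)]
    · simp
    · intro t _
      rw [heq, integral_indicator_const _ (hset t), measureReal_def, hM.hXdist t j hj1 hj,
        ENNReal.toReal_ofReal (hM.hf_pos j hj1 hj).le]
      simp
  · intro t _
    rw [heq]
    exact (integrable_const _).indicator (hset t)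

lemma DR_bdd [MeasurableSpace Ω] {μ : Measure Ω} {m : ℕ} {a f : ℕ → ℝ} {X U : ℕ → Ω → ℝ}
    (hM : Model μ m a f X U) (n k : ℕ) :
    BddAbove {v : ℝ | ∃ s : ℕ → ℝ,
    (∀ j ∈ Icc 1 m, 0 ≤ s j ∧ s j ≤ (n : ℝ) * f j) ∧
    (∑ j ∈ Icc 1 m, s j) ≤ (k : ℝ) ∧ v = ∑ j ∈ Icc 1 m, a j * s j} := by
  refine ⟨∑ j ∈ Icc 1 m, a j * (n * f j), ?_⟩
  rintro v ⟨s, hs, -, rfl⟩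
  refine Finset.sum_le_sum fun j hj => ?_
  have h := Finset.mem_Icc.1 hj
  exact mul_le_mul_of_nonneg_left (hs j hj).2 (hM.a_pos h.1 h.2).le

lemma Voff_le_DR [MeasurableSpace Ω] {μ : Measure Ω} {m : ℕ} {a f : ℕ → ℝ} {X U : ℕ → Ω → ℝ}
    (hM : Model μ m a f X U) (n k : ℕ) : Voff μ m a X n k ≤ DRval m a f n k := by
  have := hM.hprob
  have hZi : ∀ j, Integrable (Zc X (a j) n) μ := fun j =>
    Integrable.of_bound (Zc_meas X hM.hXmeas _ _).aestronglyMeasurable n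
      (Filter.Eventually.of_forall fun ω => by
        rw [Real.norm_eq_abs, abs_of_nonneg (Zc_nonneg _ _ _ _)]; exact Zc_le _ _ _ _)
  have hS0 : ∀ j ω, 0 ≤ Soff a X k n j ω := fun j ω =>
    le_min (Zc_nonneg _ _ _ _) (le_max_right _ _)
  have hSle : ∀ j ω, Soff a X k n j ω ≤ Zc X (a j) n ω := fun j ω => min_le_left _ _
  have hSm : ∀ j, Measurable (Soff a X k n j) := fun j => by
    unfold Soff
    refine (Zc_meas X hM.hXmeas _ _).min (Measurable.max ?_ measurable_const)
    exact measurable_const.sub (Finset.measurable_fun_sum _ fun i _ => Zc_meas X hM.hXmeas _ _)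
  have hSi : ∀ j, Integrable (Soff a X k n j) μ := fun j =>
    (hZi j).mono' (hSm j).aestronglyMeasurable (Filter.Eventually.of_forall fun ω => by
        rw [Real.norm_eq_abs, abs_of_nonneg (hS0 _ _)]; exact hSle _ _)
  refine le_csSup (DR_bdd hM n k) ⟨fun j => ∫ ω, Soff a X k n j ω ∂μ, ?_, ?_, rfl⟩
  · intro j hj
    have h := Finset.mem_Icc.1 hj
    refine ⟨integral_nonneg (hS0 j), ?_⟩
    rw [← integral_Zc hM n j h.1 h.2]
    exact integral_mono (hSi j) (hZi j) (hSle j)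
  · rw [← integral_finsetSum _ (fun j _ => hSi j)]
    calc _ ≤ ∫ ω, (k : ℝ) ∂μ := by
          refine integral_mono (integrable_finsetSum _ fun j _ => hSi j) (integrable_const _) ?_
          intro ω
          simp only [Soff_sum]
          exact min_le_left _ _
      _ = k := by simp

lemma DR_le [MeasurableSpace Ω] {μ : Measure Ω} {m : ℕ} {a f : ℕ → ℝ} {X U : ℕ → Ω → ℝ}
    (hM : Model μ m a f X U) (n k : ℕ) (jid : ℕ) (hj1 : 1 ≤ jid) (hj2 : jid ≤ m)
    (q : ℕ → ℝ) (hlt : ∀ j, j < jid → q j = 1) (hgt : ∀ j, jid < j → q j = 0)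
    (hsum : ∑ j ∈ Icc 1 m, n * f j * q j = k) :
    DRval m a f n k ≤ ∑ j ∈ Icc 1 m, a j * (n * f j * q j) := by
  refine csSup_le ⟨0, fun _ => 0, ?_, by simp, by simp⟩ ?_
  · intro j hj
    have h := Finset.mem_Icc.1 hj
    have := hM.hf_pos j h.1 h.2
    exact ⟨le_rfl, by positivity⟩
  · rintro v ⟨s, hs, hk, rfl⟩
    have h1 : ∑ j ∈ Icc 1 m, (a j - a jid) * s j ≤ ∑ j ∈ Icc 1 m, (a j - a jid) * (n * f j * q j) := by
      refine Finset.sum_le_sum fun j hj => ?_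
      have h := Finset.mem_Icc.1 hj
      obtain ⟨h0, hn⟩ := hs j hj
      rcases lt_trichotomy j jid with hh | hh | hh
      · rw [hlt j hh, mul_one]
        exact mul_le_mul_of_nonneg_left hn (sub_nonneg.2 (hM.a_anti h.1 hh hj2).le)
      · subst hh; simp
      · rw [hgt j hh, mul_zero, mul_zero]
        exact mul_nonpos_of_nonpos_of_nonneg (sub_nonpos.2 (hM.a_anti hj1 hh h.2).le) h0
    simp only [sub_mul, Finset.sum_sub_distrib, ← Finset.mul_sum, hsum] at h1
    have := mul_le_mul_of_nonneg_left hk (hM.a_pos hj1 hj2).le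
    linarith

lemma Ind_meas [MeasurableSpace Ω] {μ : Measure Ω} {m : ℕ} {a f : ℕ → ℝ} {X U : ℕ → Ω → ℝ}
    (hM : Model μ m a f X U) (p : ℕ → ℕ → ℝ) (j t : ℕ) : Measurable (Ind a p X U j t) := by
  unfold Ind
  refine Measurable.ite ?_ measurable_const measurable_const
  exact (hM.hUmeas t measurableSet_Iic).inter (hM.hXmeas t (measurableSet_singleton (a j)))

lemma Ind_nonneg (a : ℕ → ℝ) (p : ℕ → ℕ → ℝ) (X U : ℕ → Ω → ℝ) (j t : ℕ) (ω : Ω) :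
    0 ≤ Ind a p X U j t ω := by
  unfold Ind; split_ifs <;> norm_num

lemma Ind_le (a : ℕ → ℝ) (p : ℕ → ℕ → ℝ) (X U : ℕ → Ω → ℝ) (j t : ℕ) (ω : Ω) :
    Ind a p X U j t ω ≤ 1 := by
  unfold Ind; split_ifs <;> norm_num

lemma Ind_integrable [MeasurableSpace Ω] {μ : Measure Ω} {m : ℕ} {a f : ℕ → ℝ} {X U : ℕ → Ω → ℝ}
    (hM : Model μ m a f X U) (p : ℕ → ℕ → ℝ) (j t : ℕ) : Integrable (Ind a p X U j t) μ := by
  have := hM.hprob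
  exact Integrable.of_bound (Ind_meas hM p j t).aestronglyMeasurable 1
      (Filter.Eventually.of_forall fun ω => by
        rw [Real.norm_eq_abs, abs_of_nonneg (Ind_nonneg _ _ _ _ _ _ _)]; exact Ind_le _ _ _ _ _ _ _)

lemma integral_Ind [MeasurableSpace Ω] {μ : Measure Ω} {m : ℕ} {a f : ℕ → ℝ} {X U : ℕ → Ω → ℝ}
    (hM : Model μ m a f X U) (p : ℕ → ℕ → ℝ) (j t : ℕ) (hj1 : 1 ≤ j) (hj : j ≤ m)
    (h0 : 0 ≤ p j t) (h1 : p j t ≤ 1) :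
    ∫ ω, Ind a p X U j t ω ∂μ = f j * p j t := by
  have := hM.hprob
  have hs : MeasurableSet (X t ⁻¹' {a j} ∩ U t ⁻¹' Set.Iic (p j t)) :=
    (hM.hXmeas t (measurableSet_singleton (a j))).inter (hM.hUmeas t measurableSet_Iic)
  have heq : (fun ω => Ind a p X U j t ω)
      = Set.indicator (X t ⁻¹' {a j} ∩ U t ⁻¹' Set.Iic (p j t)) (fun _ => 1) := by
    ext ω
    unfold Ind
    by_cases h : U t ω ≤ p j t ∧ X t ω = a j
    · rw [if_pos h, Set.indicator_of_mem (show ω ∈ X t ⁻¹' {a j} ∩ U t ⁻¹' Set.Iic (p j t) from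
        ⟨h.2, h.1⟩)]
    · rw [if_neg h, Set.indicator_of_notMem]
      exact fun h' => h ⟨h'.2, h'.1⟩
  have hU : μ (U t ⁻¹' Set.Iic (p j t)) = ENNReal.ofReal (p j t) := by
    rw [← Measure.map_apply (hM.hUmeas t) measurableSet_Iic, hM.hUdist,
      Measure.restrict_apply measurableSet_Iic]
    have : Set.Iic (p j t) ∩ Set.Icc (0 : ℝ) 1 = Set.Icc 0 (p j t) := by
      ext x; simp only [Set.mem_inter_iff, Set.mem_Iic, Set.mem_Icc]
      constructor
      · rintro ⟨h, h', -⟩; exact ⟨h', h⟩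
      · rintro ⟨h, h'⟩; exact ⟨h', h, h'.trans h1⟩
    rw [this, Real.volume_Icc, sub_zero]
  have hX : μ (X t ⁻¹' {a j}) = ENNReal.ofReal (f j) := hM.hXdist t j hj1 hj
  rw [heq, integral_indicator_const _ hs, measureReal_def,
    (hM.hXUIndep t).measure_inter_preimage_eq_mul _ _ (measurableSet_singleton (a j))
      measurableSet_Iic, hU, hX, ENNReal.toReal_mul, ENNReal.toReal_ofReal h0,
    ENNReal.toReal_ofReal (hM.hf_pos j hj1 hj).le]
  simp

lemma Bna_eq (m : ℕ) (a : ℕ → ℝ) (p : ℕ → ℕ → ℝ) (X U : ℕ → Ω → ℝ) (t : ℕ) (ω : Ω) :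
    Bna m a p X U t ω = ∑ j ∈ Icc 1 m, Ind a p X U j t ω := rfl

lemma Bna_if [MeasurableSpace Ω] {μ : Measure Ω} {m : ℕ} {a f : ℕ → ℝ} {X U : ℕ → Ω → ℝ}
    (hM : Model μ m a f X U) (p : ℕ → ℕ → ℝ) (j t : ℕ) (hj1 : 1 ≤ j) (hj : j ≤ m) (ω : Ω) :
    (if X t ω = a j then Bna m a p X U t ω else 0) = Ind a p X U j t ω := by
  split_ifs with h
  · rw [Bna_eq, Finset.sum_eq_single j]
    · intro i hi hne
      have hi' := Finset.mem_Icc.1 hi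
      unfold Ind
      rw [if_neg]
      rintro ⟨-, h2⟩
      exact hne (hM.a_inj hi'.1 hi'.2 hj1 hj (h2 ▸ h))
    · intro hh; exact absurd (Finset.mem_Icc.2 ⟨hj1, hj⟩) hh
  · simp [Ind, h]

lemma Bna_nonneg (m : ℕ) (a : ℕ → ℝ) (p : ℕ → ℕ → ℝ) (X U : ℕ → Ω → ℝ) (t : ℕ) (ω : Ω) :
    0 ≤ Bna m a p X U t ω := Finset.sum_nonneg fun j _ => Ind_nonneg a p X U j t ω

lemma Bna_le [MeasurableSpace Ω] {μ : Measure Ω} {m : ℕ} {a f : ℕ → ℝ} {X U : ℕ → Ω → ℝ}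
    (hM : Model μ m a f X U) (p : ℕ → ℕ → ℝ) (t : ℕ) (ω : Ω) : Bna m a p X U t ω ≤ 1 := by
  by_cases h : ∃ j ∈ Icc 1 m, X t ω = a j
  · obtain ⟨j, hj, h⟩ := h
    have hj := Finset.mem_Icc.1 hj
    have := Bna_if hM p j t hj.1 hj.2 ω
    rw [if_pos h] at this
    rw [this]; exact Ind_le _ _ _ _ _ _ _
  · push Not at h
    rw [Bna_eq, Finset.sum_eq_zero]
    · norm_num
    · intro j hj; simp [Ind, h j hj]

lemma Bna_meas [MeasurableSpace Ω] {μ : Measure Ω} {m : ℕ} {a f : ℕ → ℝ} {X U : ℕ → Ω → ℝ}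
    (hM : Model μ m a f X U) (p : ℕ → ℕ → ℝ) (t : ℕ) : Measurable (Bna m a p X U t) :=
  Finset.measurable_fun_sum _ fun j _ => Ind_meas hM p j t

lemma nu_mem (m : ℕ) (a : ℕ → ℝ) (p : ℕ → ℕ → ℝ) (X U : ℕ → Ω → ℝ) (n k : ℕ) (hn : 1 ≤ n)
    (ω : Ω) : 1 ≤ nuNA m a p X U n k ω ∧
      ((k : ℝ) ≤ ∑ t ∈ range (nuNA m a p X U n k ω), Bna m a p X U t ω
        ∨ n ≤ nuNA m a p X U n k ω) :=
  Nat.sInf_mem (s := {r : ℕ | 1 ≤ r ∧ ((k : ℝ) ≤ ∑ t ∈ range r, Bna m a p X U t ω ∨ n ≤ r)})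
    ⟨n, hn, Or.inr le_rfl⟩

lemma nu_le (m : ℕ) (a : ℕ → ℝ) (p : ℕ → ℕ → ℝ) (X U : ℕ → Ω → ℝ) (n k : ℕ) (hn : 1 ≤ n)
    (ω : Ω) : nuNA m a p X U n k ω ≤ n :=
  Nat.sInf_le ⟨hn, Or.inr le_rfl⟩

lemma nu_meas [MeasurableSpace Ω] {μ : Measure Ω} {m : ℕ} {a f : ℕ → ℝ} {X U : ℕ → Ω → ℝ}
    (hM : Model μ m a f X U) (p : ℕ → ℕ → ℝ) (n k : ℕ) (hn : 1 ≤ n) (t : ℕ) :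
    MeasurableSet {ω | t < nuNA m a p X U n k ω} := by
  have : {ω | t < nuNA m a p X U n k ω} =
      ⋂ r ∈ range (t + 1), {ω | ¬ (1 ≤ r ∧ ((k : ℝ) ≤ ∑ s ∈ range r, Bna m a p X U s ω ∨ n ≤ r))} := by
    ext ω
    simp only [Set.mem_ofPred_eq, Set.mem_iInter, Finset.mem_range]
    constructor
    · intro h r hr
      exact Nat.notMem_of_lt_sInf (show r < nuNA m a p X U n k ω by omega)
    · intro h
      by_contra hc
      exact h _ (by omega) (nu_mem m a p X U n k hn ω)
  rw [this]
  refine Finset.measurableSet_biInter _ fun r _ => ?_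
  apply MeasurableSet.compl (s := {ω | 1 ≤ r ∧ ((k : ℝ) ≤ ∑ s ∈ range r, Bna m a p X U s ω ∨ n ≤ r)})
  refine MeasurableSet.inter (MeasurableSet.const _) (MeasurableSet.union ?_ (MeasurableSet.const _))
  exact measurableSet_le measurable_const
    (Finset.measurable_fun_sum _ fun s _ => Bna_meas hM p s)

lemma stopped_eq (m : ℕ) (a : ℕ → ℝ) (p : ℕ → ℕ → ℝ) (X U : ℕ → Ω → ℝ) (n k : ℕ) (hn : 1 ≤ n)
    (g : ℕ → ℝ) (ω : Ω) : ∑ t ∈ range (nuNA m a p X U n k ω), g t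
      = ∑ t ∈ range n, if t < nuNA m a p X U n k ω then g t else 0 := by
  rw [← Finset.sum_filter]
  congr 1
  ext t
  have := nu_le m a p X U n k hn ω
  simp only [Finset.mem_range, Finset.mem_filter]
  omega

lemma stopped_integrable [MeasurableSpace Ω] {μ : Measure Ω} {m : ℕ} {a f : ℕ → ℝ}
    {X U : ℕ → Ω → ℝ}
    (hM : Model μ m a f X U) (p : ℕ → ℕ → ℝ) (n k : ℕ) (hn : 1 ≤ n) (j : ℕ) :
    Integrable (fun ω => ∑ t ∈ range (nuNA m a p X U n k ω), Ind a p X U j t ω) μ := by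
  have : (fun ω => ∑ t ∈ range (nuNA m a p X U n k ω), Ind a p X U j t ω) =
      fun ω => ∑ t ∈ range n,
        Set.indicator {ω | t < nuNA m a p X U n k ω} (Ind a p X U j t) ω := by
    ext ω
    rw [stopped_eq m a p X U n k hn]
    refine Finset.sum_congr rfl fun t _ => ?_
    by_cases h : t < nuNA m a p X U n k ω
    · rw [if_pos h, Set.indicator_of_mem (show ω ∈ {ω | t < nuNA m a p X U n k ω} from h)]
    · rw [if_neg h, Set.indicator_of_notMem (show ω ∉ {ω | t < nuNA m a p X U n k ω} from h)]
  rw [this]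
  exact integrable_finsetSum _ fun t _ => (Ind_integrable hM p j t).indicator (nu_meas hM p n k hn t)

/-- Pointwise bound of the loss due to stopping. -/
lemma loss_le [MeasurableSpace Ω] {μ : Measure Ω} {m : ℕ} {a f : ℕ → ℝ} {X U : ℕ → Ω → ℝ}
    (hM : Model μ m a f X U) (p : ℕ → ℕ → ℝ) (n k : ℕ) (hn : 1 ≤ n) (ω : Ω) :
    ∑ j ∈ Icc 1 m, a j * ∑ t ∈ range n, Ind a p X U j t ω
      - ∑ j ∈ Icc 1 m, a j * ∑ t ∈ range (nuNA m a p X U n k ω), Ind a p X U j t ω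
      ≤ a 1 * |∑ t ∈ range n, Bna m a p X U t ω - k| := by
  have hle := nu_le m a p X U n k hn ω
  have hmem := (nu_mem m a p X U n k hn ω).2
  set ν := nuNA m a p X U n k ω
  have hsub : ∀ g : ℕ → ℝ, ∑ t ∈ range n, g t - ∑ t ∈ range ν, g t = ∑ t ∈ Ico ν n, g t := fun g =>
    (Finset.sum_Ico_eq_sub g hle).symm
  have ha1 : 0 < a 1 := hM.a_pos le_rfl hM.hm
  rw [← Finset.sum_sub_distrib]
  calc _ = ∑ j ∈ Icc 1 m, a j * ∑ t ∈ Ico ν n, Ind a p X U j t ω := by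
        refine Finset.sum_congr rfl fun j _ => ?_
        rw [← mul_sub, hsub]
    _ ≤ ∑ j ∈ Icc 1 m, a 1 * ∑ t ∈ Ico ν n, Ind a p X U j t ω := by
        refine Finset.sum_le_sum fun j hj => ?_
        have h := Finset.mem_Icc.1 hj
        exact mul_le_mul_of_nonneg_right (hM.a_anti_le le_rfl h.1 h.2)
          (Finset.sum_nonneg fun t _ => Ind_nonneg _ _ _ _ _ _ _)
    _ = a 1 * ∑ t ∈ Ico ν n, Bna m a p X U t ω := by
        rw [← Finset.mul_sum, Finset.sum_comm]; rfl
    _ ≤ _ := by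
        refine mul_le_mul_of_nonneg_left ?_ ha1.le
        rcases hmem with h | h
        · rw [← hsub]
          exact le_trans (by linarith) (le_abs_self _)
        · rw [Finset.Ico_eq_empty (by omega), Finset.sum_empty]
          exact abs_nonneg _

/-- The mean absolute deviation of the number of candidates passing the test. -/
lemma dev_le [MeasurableSpace Ω] {μ : Measure Ω} {m : ℕ} {a f : ℕ → ℝ} {X U : ℕ → Ω → ℝ}
    (hM : Model μ m a f X U) (p : ℕ → ℕ → ℝ) (n k : ℕ)
    (hmean : ∫ ω, ∑ t ∈ range n, Bna m a p X U t ω ∂μ = k) :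
    ∫ ω, |∑ t ∈ range n, Bna m a p X U t ω - k| ∂μ ≤ Real.sqrt n := by
  have := hM.hprob
  have hBL : ∀ t, MemLp (Bna m a p X U t) 2 μ := fun t =>
    MemLp.of_bound (Bna_meas hM p t).aestronglyMeasurable 1
      (Filter.Eventually.of_forall fun ω => by
        rw [Real.norm_eq_abs, abs_of_nonneg (Bna_nonneg _ _ _ _ _ _ _)]; exact Bna_le hM _ _ _)
  have hind : Set.Pairwise (↑(range n) : Set ℕ)
      fun i j => IndepFun (Bna m a p X U i) (Bna m a p X U j) μ := by
    intro i _ j _ hij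
    have hg : ∀ t, Measurable (fun x : ℝ × ℝ =>
        ∑ j ∈ Icc 1 m, if x.2 ≤ p j t ∧ x.1 = a j then (1 : ℝ) else 0) := by
      intro t
      refine Finset.measurable_fun_sum _ fun j _ => Measurable.ite ?_ measurable_const measurable_const
      exact (measurable_snd measurableSet_Iic).inter (measurable_fst (measurableSet_singleton (a j)))
    exact (hM.hIndep.indepFun hij).comp (hg i) (hg j)
  have hvar := IndepFun.variance_sum (fun i _ => hBL i) hind
  have hvar1 : ∀ t, variance (Bna m a p X U t) μ ≤ 1 := fun t => by
    refine (variance_le_expectation_sq (hBL t).aestronglyMeasurable).trans ?_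
    calc _ ≤ ∫ ω, (1 : ℝ) ∂μ := by
          refine integral_mono (hBL t).integrable_sq (integrable_const _) fun ω => ?_
          have h0 := Bna_nonneg m a p X U t ω
          have h1 := Bna_le hM p t ω
          simp only [Pi.pow_apply]
          nlinarith
      _ = 1 := by simp
  have hvn : variance (∑ t ∈ range n, Bna m a p X U t) μ ≤ n := by
    rw [hvar]
    calc _ ≤ ∑ t ∈ range n, (1 : ℝ) := Finset.sum_le_sum fun t _ => hvar1 t
      _ = n := by simp
  have hSL : MemLp (∑ t ∈ range n, Bna m a p X U t) 2 μ := memLp_finsetSum' _ fun t _ => hBL t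
  rw [variance_eq_integral hSL.aemeasurable] at hvn
  simp only [Finset.sum_apply, hmean] at hvn
  have hYL : MemLp (fun ω => |∑ t ∈ range n, Bna m a p X U t ω - k|) 2 μ := by
    have h := (hSL.sub (memLp_const (k : ℝ))).abs
    refine h.ae_eq (Filter.Eventually.of_forall fun ω => ?_)
    simp
  have h0 := variance_nonneg (fun ω => |∑ t ∈ range n, Bna m a p X U t ω - k|) μ
  rw [variance_eq_sub hYL] at h0
  simp only [Pi.pow_apply, sq_abs] at h0
  exact Real.le_sqrt_of_sq_le (by linarith)

/-- Lemma 3, regret of the non-adaptive index policy: for any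
`ε' ∈ (0,1)` and any `(n,k)` with `ε' ≤ k/n`, the index policy satisfies
`V_off^*(n,k) - V_on^id(n,k) ≤ DR(n,k) - V_on^id(n,k) ≤ (ε')⁻¹ a_1 √n`. -/
theorem index_policy_regret {Ω : Type*} [MeasurableSpace Ω] (μ : Measure Ω)
    (m : ℕ) (a f : ℕ → ℝ) (X U : ℕ → Ω → ℝ) (hM : Model μ m a f X U)
    (ε' : ℝ) (hε'0 : 0 < ε') (hε'1 : ε' < 1)
    (n k : ℕ) (hn : 1 ≤ n) (hkn : k ≤ n) (hk : ε' ≤ (k : ℝ) / (n : ℝ))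
    (jid : ℕ) (hjid1 : 1 ≤ jid) (hjid2 : jid ≤ m)
    (hjlo : Fbar f jid ≤ (k : ℝ) / (n : ℝ)) (hjhi : (k : ℝ) / (n : ℝ) < Fbar f (jid + 1))
    (pid : ℕ → ℕ → ℝ)
    (hpid : ∀ j t, pid j t =
      if j + 1 ≤ jid then 1
      else if j = jid then ((k : ℝ) / (n : ℝ) - Fbar f jid) / f jid
      else 0) :
    Voff μ m a X n k - VonNA μ m a pid X U n k ≤ DRval m a f n k - VonNA μ m a pid X U n k ∧
    DRval m a f n k - VonNA μ m a pid X U n k ≤ ε'⁻¹ * a 1 * Real.sqrt n := by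
  have hnpos : (0 : ℝ) < n := by exact_mod_cast hn
  have := hM.hprob
  have hfj := hM.hf_pos jid hjid1 hjid2
  have hFs : Fbar f (jid + 1) = Fbar f jid + f jid := by
    unfold Fbar
    rw [Nat.add_sub_cancel, sum_Icc_pred _ _ hjid1]
  set q : ℕ → ℝ := fun j => if j + 1 ≤ jid then 1
      else if j = jid then ((k : ℝ) / (n : ℝ) - Fbar f jid) / f jid else 0 with hq
  have hpq : ∀ j t, pid j t = q j := hpid
  have hq01 : ∀ j, 0 ≤ q j ∧ q j ≤ 1 := by
    intro j
    simp only [hq]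
    split_ifs
    · norm_num
    · exact ⟨div_nonneg (by linarith) hfj.le, (div_le_one hfj).2 (by linarith)⟩
    · norm_num
  have hlt : ∀ j, j < jid → q j = 1 := fun j hj => by
    simp only [hq]; rw [if_pos (by omega)]
  have hgt : ∀ j, jid < j → q j = 0 := fun j hj => by
    simp only [hq]; rw [if_neg (by omega), if_neg (by omega)]
  have hqj : q jid = ((k : ℝ) / (n : ℝ) - Fbar f jid) / f jid := by simp [hq]
  have hsum : ∑ j ∈ Icc 1 m, n * f j * q j = k := by
    have h1 : ∑ j ∈ Icc 1 m, n * f j * q j = ∑ j ∈ Icc 1 jid, n * f j * q j := by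
      symm
      refine Finset.sum_subset (Finset.Icc_subset_Icc_right hjid2) fun j hj hj' => ?_
      rw [hgt j, mul_zero]
      simp only [Finset.mem_Icc] at hj hj'
      omega
    have h2 : ∑ j ∈ Icc 1 (jid - 1), n * f j * q j = n * Fbar f jid := by
      unfold Fbar
      rw [Finset.mul_sum]
      refine Finset.sum_congr rfl fun j hj => ?_
      simp only [Finset.mem_Icc] at hj
      rw [hlt j (by omega), mul_one]
    rw [h1, sum_Icc_pred _ _ hjid1, h2, hqj]
    field_simp
    ring
  have hDR := DR_le hM n k jid hjid1 hjid2 q hlt hgt hsum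
  have hI : ∀ j ∈ Icc 1 m, ∫ ω, ∑ t ∈ range n, Ind a pid X U j t ω ∂μ = n * f j * q j := by
    intro j hj
    have h := Finset.mem_Icc.1 hj
    rw [integral_finsetSum _ fun t _ => Ind_integrable hM pid j t,
      Finset.sum_congr rfl (g := fun _ => f j * q j)]
    · simp [mul_assoc]
    · intro t _
      rw [integral_Ind hM pid j t h.1 h.2 (hpq j t ▸ (hq01 j).1) (hpq j t ▸ (hq01 j).2), hpq]
  have hIi : ∀ j, Integrable (fun ω => ∑ t ∈ range n, Ind a pid X U j t ω) μ := fun j =>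
    integrable_finsetSum _ fun t _ => Ind_integrable hM pid j t
  have hmean : ∫ ω, ∑ t ∈ range n, Bna m a pid X U t ω ∂μ = k := by
    simp only [Bna_eq]
    rw [← hsum, ← Finset.sum_congr rfl hI, ← integral_finsetSum _ fun j _ => hIi j]
    congr 1
    ext ω
    exact Finset.sum_comm
  have hdev := dev_le hM pid n k hmean
  have hVon : VonNA μ m a pid X U n k =
      ∫ ω, ∑ j ∈ Icc 1 m, a j * ∑ t ∈ range (nuNA m a pid X U n k ω), Ind a pid X U j t ω ∂μ := by
    rw [integral_finsetSum _ fun j _ => (stopped_integrable hM pid n k hn j).const_mul _]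
    unfold VonNA
    refine Finset.sum_congr rfl fun j hj => ?_
    have h := Finset.mem_Icc.1 hj
    rw [integral_const_mul]
    simp only [Bna_if hM pid j _ h.1 h.2]
  have hfull : ∑ j ∈ Icc 1 m, a j * (n * f j * q j) =
      ∫ ω, ∑ j ∈ Icc 1 m, a j * ∑ t ∈ range n, Ind a pid X U j t ω ∂μ := by
    rw [integral_finsetSum _ fun j _ => (hIi j).const_mul _]
    refine Finset.sum_congr rfl fun j hj => ?_
    rw [integral_const_mul, hI j hj]
  have ha1 : 0 < a 1 := hM.a_pos le_rfl hM.hm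
  refine ⟨by linarith [Voff_le_DR hM n k], ?_⟩
  have hint1 := integrable_finsetSum (Icc 1 m) fun j (_ : j ∈ Icc 1 m) => (hIi j).const_mul (a j)
  have hint2 := integrable_finsetSum (Icc 1 m) fun j (_ : j ∈ Icc 1 m) =>
    (stopped_integrable hM pid n k hn j).const_mul (a j)
  have hintB : Integrable (fun ω => a 1 * |∑ t ∈ range n, Bna m a pid X U t ω - k|) μ := by
    refine (Integrable.abs (Integrable.sub ?_ (integrable_const _))).const_mul _
    exact integrable_finsetSum _ fun t _ =>
      integrable_finsetSum _ fun j _ => Ind_integrable hM pid j t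
  have hinv : 1 ≤ ε'⁻¹ := (one_le_inv₀ hε'0).2 hε'1.le
  calc _ ≤ ∑ j ∈ Icc 1 m, a j * (n * f j * q j) - VonNA μ m a pid X U n k := by linarith
    _ ≤ ∫ ω, a 1 * |∑ t ∈ range n, Bna m a pid X U t ω - k| ∂μ := by
        rw [hVon, hfull, ← integral_sub hint1 hint2]
        exact integral_mono (hint1.sub hint2) hintB fun ω => loss_le hM pid n k hn ω
    _ = a 1 * ∫ ω, |∑ t ∈ range n, Bna m a pid X U t ω - k| ∂μ := integral_const_mul _ _
    _ ≤ a 1 * Real.sqrt n := mul_le_mul_of_nonneg_left hdev ha1.le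
    _ ≤ ε'⁻¹ * (a 1 * Real.sqrt n) :=
        le_mul_of_one_le_left (mul_nonneg ha1.le (Real.sqrt_nonneg _)) hinv
    _ = _ := by ring

end MultiSecretary
end
end

section
/- There exists a constant M < ∞ depending only on ε, m, a_1, …, a_m such that 0 ≤ DR(n,k) − V_off^*(n,k) ≤ M √n for all (n,k) ∈ 𝒯. Furthermore, for any 0 < ε' < ε, letting 𝒯' = {(n,k) ∈ 𝒯 : F̄(a_j) + ε' ≤ k/n ≤ F̄(a_{j+1}) − ε' for some j ∈ [m]}, one has 0 ≤ DR(n,k) − V_off^*(n,k) ≤ a_1 m/(4ε') for all (n,k) ∈ 𝒯'. -/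
open MeasureTheory ProbabilityTheory Finset

noncomputable section

namespace MultiSecretary

variable {Ω : Type*}

lemma Icc_one_succ_sum (g : ℕ → ℝ) (j : ℕ) :
    ∑ i ∈ Icc 1 (j + 1), g i = ∑ i ∈ Icc 1 j, g i + g (j + 1) :=
  Finset.sum_Icc_succ_top (by omega) g

lemma abel_aux (a u : ℕ → ℝ) (m : ℕ) :
    ∑ j ∈ Icc 1 m, a j * u j =
      ∑ j ∈ Icc 1 m, (a j - a (j + 1)) * ∑ i ∈ Icc 1 j, u i
        + a (m + 1) * ∑ i ∈ Icc 1 m, u i := by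
  induction m with
  | zero => simp
  | succ m ih => rw [Icc_one_succ_sum, Icc_one_succ_sum, ih, Icc_one_succ_sum]; ring

/-- The increments of the abilities, with `a_{m+1} = 0`. -/
def dinc (a : ℕ → ℝ) (m j : ℕ) : ℝ := a j - if j + 1 ≤ m then a (j + 1) else 0

lemma abel (a u : ℕ → ℝ) (m : ℕ) :
    ∑ j ∈ Icc 1 m, a j * u j = ∑ j ∈ Icc 1 m, dinc a m j * ∑ i ∈ Icc 1 j, u i := by
  have h := abel_aux (fun j => if j ≤ m then a j else 0) u m
  have h1 : ¬ (m + 1 ≤ m) := by omega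
  simp only [h1, if_false, zero_mul, add_zero] at h
  rw [← Finset.sum_congr rfl (g := fun j => a j * u j)
    (f := fun j => (if j ≤ m then a j else 0) * u j), h]
  · refine Finset.sum_congr rfl fun j hj => ?_
    rw [Finset.mem_Icc] at hj
    simp [dinc, hj.2]
  · intro j hj
    rw [Finset.mem_Icc] at hj
    simp [hj.2]

lemma dinc_sum (a : ℕ → ℝ) (m : ℕ) (hm : 1 ≤ m) : ∑ j ∈ Icc 1 m, dinc a m j = a 1 := by
  have h := abel a (fun j => if j = 1 then 1 else 0) m
  have h2 : ∀ j ∈ Icc 1 m, dinc a m j * ∑ i ∈ Icc 1 j, (if i = 1 then (1:ℝ) else 0)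
      = dinc a m j := by
    intro j hj
    rw [Finset.mem_Icc] at hj
    rw [Finset.sum_ite_eq' (Icc 1 j) 1]
    simp [hj.1]
  rw [Finset.sum_congr rfl h2] at h
  rw [← h]
  simp [hm]

lemma min_tele (u : ℕ → ℝ) (k : ℝ) (j : ℕ) (hu : 0 ≤ u (j + 1)) :
    min (u (j + 1)) (max (k - ∑ i ∈ Icc 1 j, u i) 0) =
      min k (∑ i ∈ Icc 1 (j + 1), u i) - min k (∑ i ∈ Icc 1 j, u i) := by
  rw [Icc_one_succ_sum]
  generalize ∑ i ∈ Icc 1 j, u i = P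
  generalize u (j + 1) = v at *
  rcases le_total k P with h | h
  · rw [max_eq_right (by linarith), min_eq_right hu, min_eq_left (by linarith : k ≤ P + v),
      min_eq_left h]
    ring
  · rw [max_eq_left (by linarith), min_eq_right h]
    rcases le_total k (P + v) with h' | h'
    · rw [min_eq_left h', min_eq_right (by linarith)]
    · rw [min_eq_right h', min_eq_left (by linarith)]
      ring

lemma min_sum (u : ℕ → ℝ) (k : ℝ) (hk : 0 ≤ k) (j : ℕ) (hu : ∀ i, 1 ≤ i → i ≤ j → 0 ≤ u i) :
    ∑ i ∈ Icc 1 j, min (u i) (max (k - ∑ l ∈ Icc 1 (i - 1), u l) 0) =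
      min k (∑ i ∈ Icc 1 j, u i) := by
  induction j with
  | zero => simp [hk]
  | succ j ih =>
    rw [Icc_one_succ_sum, ih (fun i h1 h2 => hu i h1 (by omega)), Nat.add_sub_cancel,
      min_tele u k j (hu _ (by omega) le_rfl)]
    ring

section
variable [MeasurableSpace Ω] {μ : Measure Ω} {m : ℕ} {a f : ℕ → ℝ} {X : ℕ → Ω → ℝ}

lemma ModelX.dinc_nonneg (H : ModelX μ m a f X) (j : ℕ) (hj : j ∈ Icc 1 m) :
    0 ≤ dinc a m j := by
  rw [Finset.mem_Icc] at hj
  unfold dinc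
  split_ifs with h
  · linarith [H.ha_anti j hj.1 h]
  · have : j = m := by omega
    subst this
    linarith [H.ha_pos]

lemma ModelX.DR_eq (H : ModelX μ m a f X) (n k : ℕ) :
    DRval m a f n k =
      ∑ j ∈ Icc 1 m, dinc a m j * min (k : ℝ) (∑ i ∈ Icc 1 j, (n : ℝ) * f i) := by
  have hnf : ∀ i, 1 ≤ i → i ≤ m → 0 ≤ (n : ℝ) * f i := fun i h1 h2 =>
    mul_nonneg (Nat.cast_nonneg _) (H.hf_pos i h1 h2).le
  have hS := fun j (hj : j ≤ m) => min_sum (fun i => (n : ℝ) * f i) k (Nat.cast_nonneg _) j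
    (fun i h1 h2 => hnf i h1 (h2.trans hj))
  apply le_antisymm
  · apply csSup_le
    · refine ⟨0, fun _ => 0, ?_, ?_, ?_⟩
      · intro j hj
        rw [Finset.mem_Icc] at hj
        exact ⟨le_rfl, hnf j hj.1 hj.2⟩
      · simp
      · simp
    · rintro v ⟨s, hs, hsk, rfl⟩
      rw [abel]
      refine Finset.sum_le_sum fun j hj => ?_
      refine mul_le_mul_of_nonneg_left ?_ (H.dinc_nonneg j hj)
      rw [Finset.mem_Icc] at hj
      have hsub : Icc 1 j ⊆ Icc 1 m := Finset.Icc_subset_Icc le_rfl hj.2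
      refine le_min ?_ (Finset.sum_le_sum fun i hi => (hs i (hsub hi)).2)
      exact (Finset.sum_le_sum_of_subset_of_nonneg hsub fun i hi _ => (hs i hi).1).trans hsk
  · apply le_csSup
    · refine ⟨∑ j ∈ Icc 1 m, dinc a m j * k, ?_⟩
      rintro v ⟨s, hs, hsk, rfl⟩
      rw [abel]
      refine Finset.sum_le_sum fun j hj => ?_
      refine mul_le_mul_of_nonneg_left ?_ (H.dinc_nonneg j hj)
      rw [Finset.mem_Icc] at hj
      have hsub : Icc 1 j ⊆ Icc 1 m := Finset.Icc_subset_Icc le_rfl hj.2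
      exact (Finset.sum_le_sum_of_subset_of_nonneg hsub fun i hi _ => (hs i hi).1).trans hsk
    · refine ⟨fun i => min ((n : ℝ) * f i) (max ((k : ℝ) - ∑ l ∈ Icc 1 (i - 1), (n : ℝ) * f l) 0),
        ?_, ?_, ?_⟩
      · intro j hj
        rw [Finset.mem_Icc] at hj
        exact ⟨le_min (hnf j hj.1 hj.2) (le_max_right _ _), min_le_left _ _⟩
      · rw [hS m le_rfl]
        exact min_le_left _ _
      · symm
        rw [abel a (fun i => min ((n : ℝ) * f i) (max ((k : ℝ) - ∑ l ∈ Icc 1 (i - 1), (n : ℝ) * f l) 0))]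
        refine Finset.sum_congr rfl fun j hj => ?_
        rw [Finset.mem_Icc] at hj
        rw [hS j hj.2]

/-- The number of candidates among the first `n` with ability among `a_1, …, a_j`. -/
def Wc (a : ℕ → ℝ) (X : ℕ → Ω → ℝ) (n j : ℕ) (ω : Ω) : ℝ := ∑ i ∈ Icc 1 j, Zc X (a i) n ω

/-- Indicator that candidate `t` has ability among `a_1, …, a_j`. -/
def Ic (a : ℕ → ℝ) (j : ℕ) (x : ℝ) : ℝ := ∑ i ∈ Icc 1 j, if x = a i then 1 else 0

lemma Wc_eq (n j : ℕ) : Wc a X n j = ∑ t ∈ range n, fun ω => Ic a j (X t ω) := by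
  ext ω
  simp only [Wc, Zc, Ic, Finset.sum_apply]
  exact Finset.sum_comm

lemma Ic_meas (j : ℕ) : Measurable (Ic a j) := by
  unfold Ic
  refine Finset.measurable_sum _ fun i _ => ?_
  exact Measurable.ite (measurableSet_singleton (a i)) measurable_const measurable_const

lemma Ic_nonneg (j : ℕ) (x : ℝ) : 0 ≤ Ic a j x :=
  Finset.sum_nonneg fun i _ => by split_ifs <;> norm_num

lemma ModelX.anti (H : ModelX μ m a f X) : ∀ i j, 1 ≤ i → i < j → j ≤ m → a j < a i := by
  intro i j hi hij
  induction j, hij using Nat.le_induction with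
  | base => intro h; exact H.ha_anti i hi h
  | succ j hj ih => intro h; exact (H.ha_anti j (by omega) h).trans (ih (by omega))

lemma ModelX.Ic_le (H : ModelX μ m a f X) (j : ℕ) (hj : j ≤ m) (x : ℝ) : Ic a j x ≤ 1 := by
  unfold Ic
  rw [← Finset.sum_filter, Finset.sum_const, nsmul_eq_mul, mul_one]
  have : (Finset.filter (fun i => x = a i) (Icc 1 j)).card ≤ 1 := by
    rw [Finset.card_le_one]
    intro p hp q hq
    rw [Finset.mem_filter, Finset.mem_Icc] at hp hq
    by_contra hne
    rcases lt_or_gt_of_ne hne with h | h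
    · have := H.anti p q hp.1.1 h (hq.1.2.trans hj)
      linarith [hp.2, hq.2]
    · have := H.anti q p hq.1.1 h (hp.1.2.trans hj)
      linarith [hp.2, hq.2]
  exact_mod_cast this

lemma ModelX.Ic_memLp (H : ModelX μ m a f X) (j : ℕ) (hj : j ≤ m) (t : ℕ) :
    MemLp (fun ω => Ic a j (X t ω)) 2 μ := by
  haveI := H.hprob
  refine MemLp.of_bound ((Ic_meas j).comp (H.hXmeas t)).aestronglyMeasurable 1
    (Filter.Eventually.of_forall fun ω => ?_)
  rw [Real.norm_of_nonneg (Ic_nonneg j _)]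
  exact H.Ic_le j hj _

lemma ModelX.Ic_int (H : ModelX μ m a f X) (j : ℕ) (hj : j ≤ m) (t : ℕ) :
    ∫ ω, Ic a j (X t ω) ∂μ = ∑ i ∈ Icc 1 j, f i := by
  haveI := H.hprob
  have hms : ∀ i, MeasurableSet {ω | X t ω = a i} := fun i =>
    H.hXmeas t (measurableSet_singleton (a i))
  have he : ∀ i, (fun ω => if X t ω = a i then (1:ℝ) else 0)
      = Set.indicator {ω | X t ω = a i} (fun _ => (1:ℝ)) := by
    intro i; ext ω; simp [Set.indicator]
  unfold Ic
  rw [integral_finset_sum]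
  · refine Finset.sum_congr rfl fun i hi => ?_
    rw [Finset.mem_Icc] at hi
    rw [he, integral_indicator_const _ (hms i), Measure.real, H.hXdist t i hi.1 (hi.2.trans hj),
      ENNReal.toReal_ofReal (H.hf_pos i hi.1 (hi.2.trans hj)).le]
    simp
  · intro i _
    rw [he]
    exact (integrable_const _).indicator (hms i)

lemma ModelX.Wc_memLp (H : ModelX μ m a f X) (n j : ℕ) (hj : j ≤ m) :
    MemLp (Wc a X n j) 2 μ := by
  rw [Wc_eq]
  exact memLp_finset_sum' _ fun t _ => H.Ic_memLp j hj t

lemma ModelX.Wc_int (H : ModelX μ m a f X) (n j : ℕ) (hj : j ≤ m) :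
    ∫ ω, Wc a X n j ω ∂μ = ∑ i ∈ Icc 1 j, (n : ℝ) * f i := by
  haveI := H.hprob
  rw [Wc_eq]
  simp only [Finset.sum_apply]
  rw [integral_finset_sum _ fun t _ => (H.Ic_memLp j hj t).integrable one_le_two]
  simp only [H.Ic_int j hj]
  simp [Finset.mul_sum]

lemma ModelX.Wc_var (H : ModelX μ m a f X) (n j : ℕ) (hj : j ≤ m) :
    ∫ ω, (Wc a X n j ω - ∑ i ∈ Icc 1 j, (n : ℝ) * f i) ^ 2 ∂μ ≤ n := by
  haveI := H.hprob
  have h1 : ∫ ω, (Wc a X n j ω - ∑ i ∈ Icc 1 j, (n : ℝ) * f i) ^ 2 ∂μ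
      = variance (Wc a X n j) μ := by
    rw [variance_eq_integral (H.Wc_memLp n j hj).aemeasurable, H.Wc_int n j hj]
  rw [h1, Wc_eq, IndepFun.variance_sum (fun t _ => H.Ic_memLp j hj t)]
  · have : ∀ t ∈ range n, variance (fun ω => Ic a j (X t ω)) μ ≤ 1 := by
      intro t _
      refine (variance_le_expectation_sq
        (H.Ic_memLp j hj t).aestronglyMeasurable).trans ?_
      have := integral_mono (μ := μ) (H.Ic_memLp j hj t).integrable_sq
        (integrable_const (1:ℝ)) (fun ω => by
          have h0 := Ic_nonneg (a := a) j (X t ω)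
          have h1 := H.Ic_le j hj (X t ω)
          show (Ic a j (X t ω)) ^ 2 ≤ 1
          nlinarith)
      simpa using this
    refine (Finset.sum_le_sum this).trans ?_
    simp
  · intro s _ t _ hst
    exact (H.hIndep.indepFun hst).comp (Ic_meas j) (Ic_meas j)

lemma ModelX.min_integrable (H : ModelX μ m a f X) (n j : ℕ) (k : ℝ) (hj : j ≤ m) :
    Integrable (fun ω => min k (Wc a X n j ω)) μ := by
  haveI := H.hprob
  exact (integrable_const k).inf ((H.Wc_memLp n j hj).integrable one_le_two)

lemma ModelX.Voff_eq (H : ModelX μ m a f X) (n k : ℕ) :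
    Voff μ m a X n k = ∑ j ∈ Icc 1 m, dinc a m j * ∫ ω, min (k : ℝ) (Wc a X n j ω) ∂μ := by
  haveI := H.hprob
  have hZ : ∀ i ω, 0 ≤ Zc X (a i) n ω := fun i ω =>
    Finset.sum_nonneg fun t _ => by split_ifs <;> norm_num
  unfold Voff
  rw [abel]
  refine Finset.sum_congr rfl fun j hj => ?_
  rw [Finset.mem_Icc] at hj
  rw [← integral_finset_sum]
  · congr 2
    ext ω
    exact min_sum (fun i => Zc X (a i) n ω) k (Nat.cast_nonneg _) j (fun i _ _ => hZ i ω)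
  · intro i hi
    rw [Finset.mem_Icc] at hi
    have he : Soff a X k n i = fun ω => min (k : ℝ) (Wc a X n i ω) -
        min (k : ℝ) (Wc a X n (i - 1) ω) := by
      ext ω
      obtain ⟨p, rfl⟩ : ∃ p, i = p + 1 := ⟨i - 1, by omega⟩
      exact min_tele (fun i => Zc X (a i) n ω) k p (hZ _ ω)
    rw [he]
    exact (H.min_integrable n i k (by omega)).sub (H.min_integrable n (i - 1) k (by omega))

/-- the gap in one term -/
lemma ModelX.term_nonneg (H : ModelX μ m a f X) (n j : ℕ) (k : ℝ) (hj : j ≤ m) :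
    ∫ ω, min k (Wc a X n j ω) ∂μ ≤ min k (∑ i ∈ Icc 1 j, (n : ℝ) * f i) := by
  haveI := H.hprob
  refine le_min ?_ ?_
  · have := integral_mono (μ := μ) (H.min_integrable n j k hj) (integrable_const k)
      (fun ω => min_le_left _ _)
    simpa using this
  · rw [← H.Wc_int n j hj]
    exact integral_mono (H.min_integrable n j k hj) ((H.Wc_memLp n j hj).integrable one_le_two)
      (fun ω => min_le_right _ _)

/-- Generic upper bound from a pointwise quadratic bound. -/
lemma ModelX.term_le (H : ModelX μ m a f X) (n j : ℕ) (k : ℝ) (hj : j ≤ m) (l c d : ℝ)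
    (hc : 0 ≤ c)
    (hb : ∀ w : ℝ, min k (∑ i ∈ Icc 1 j, (n : ℝ) * f i) - min k w ≤
      l * (w - ∑ i ∈ Icc 1 j, (n : ℝ) * f i) + c * (w - ∑ i ∈ Icc 1 j, (n : ℝ) * f i) ^ 2 + d) :
    min k (∑ i ∈ Icc 1 j, (n : ℝ) * f i) - ∫ ω, min k (Wc a X n j ω) ∂μ ≤ c * n + d := by
  haveI := H.hprob
  have hv := H.Wc_var n j hj
  have hi := H.Wc_int n j hj
  have hL := H.Wc_memLp n j hj
  generalize ∑ i ∈ Icc 1 j, (n : ℝ) * f i = b at *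
  have hI1 : Integrable (fun ω => l * (Wc a X n j ω - b)) μ :=
    ((hL.integrable one_le_two).sub (integrable_const b)).const_mul l
  have hI2 : Integrable (fun ω => c * (Wc a X n j ω - b) ^ 2) μ :=
    ((hL.sub (memLp_const b)).integrable_sq).const_mul c
  have h := integral_mono (μ := μ) ((integrable_const (min k b)).sub (H.min_integrable n j k hj))
    ((hI1.add hI2).add (integrable_const d)) (fun ω => hb (Wc a X n j ω))
  rw [integral_sub' (integrable_const _) (H.min_integrable n j k hj),
    integral_add' (hI1.add hI2) (integrable_const d), integral_add' hI1 hI2,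
    integral_const_mul, integral_const_mul,
    integral_sub (hL.integrable one_le_two) (integrable_const b), hi] at h
  simp only [integral_const, probReal_univ, one_smul, sub_self, mul_zero, zero_add] at h
  nlinarith

lemma quad1 (k b w s : ℝ) (hs : 0 < s) :
    min k b - min k w ≤ 0 * (w - b) + 1 / (2 * s) * (w - b) ^ 2 + s / 2 := by
  have h1 : min k b - min k w ≤ |w - b| := by
    rcases le_total k b with h | h <;> rcases le_total k w with h' | h' <;>
      simp only [h, h', min_eq_left, min_eq_right] <;> cases abs_cases (w - b) <;> linarith
  have h2 : 1 / (2 * s) * (w - b) ^ 2 + s / 2 - |w - b| = (|w - b| - s) ^ 2 / (2 * s) := by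
    rw [← sq_abs (w - b)]
    field_simp
    ring
  have : 0 ≤ (|w - b| - s) ^ 2 / (2 * s) := by positivity
  linarith

lemma quad_pos (x c : ℝ) (hc : 0 < c) : x - c ≤ 1 / (4 * c) * x ^ 2 := by
  have h2 : 1 / (4 * c) * x ^ 2 - (x - c) = (x - 2 * c) ^ 2 / (4 * c) := by
    field_simp
    ring
  have : 0 ≤ (x - 2 * c) ^ 2 / (4 * c) := by positivity
  linarith

lemma quad2 (k b w c : ℝ) (hc : 0 < c) (h : b + c ≤ k) :
    min k b - min k w ≤ 1 * -(w - b) + 1 / (4 * c) * (w - b) ^ 2 + 0 := by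
  have h1 := quad_pos (w - b) c hc
  have h2 : 0 ≤ 1 / (4 * c) * (w - b) ^ 2 := by positivity
  rw [min_eq_right (by linarith : b ≤ k)]
  rcases le_total k w with h' | h' <;> simp only [h', min_eq_left, min_eq_right] <;> linarith

lemma quad3 (k b w c : ℝ) (hc : 0 < c) (h : k + c ≤ b) :
    min k b - min k w ≤ 0 * (w - b) + 1 / (4 * c) * (w - b) ^ 2 + 0 := by
  have h1 := quad_pos (-(w - b)) c hc
  rw [neg_sq] at h1
  have h2 : 0 ≤ 1 / (4 * c) * (w - b) ^ 2 := by positivity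
  rw [min_eq_left (by linarith : k ≤ b)]
  rcases le_total k w with h' | h' <;> simp only [h', min_eq_left, min_eq_right] <;> linarith

lemma ModelX.gap_eq (H : ModelX μ m a f X) (n k : ℕ) :
    DRval m a f n k - Voff μ m a X n k = ∑ j ∈ Icc 1 m, dinc a m j *
      (min (k : ℝ) (∑ i ∈ Icc 1 j, (n : ℝ) * f i) - ∫ ω, min (k : ℝ) (Wc a X n j ω) ∂μ) := by
  rw [H.DR_eq, H.Voff_eq, ← Finset.sum_sub_distrib]
  exact Finset.sum_congr rfl fun j _ => by ring

lemma ModelX.gap_nonneg (H : ModelX μ m a f X) (n k : ℕ) :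
    0 ≤ DRval m a f n k - Voff μ m a X n k := by
  rw [H.gap_eq]
  refine Finset.sum_nonneg fun j hj => mul_nonneg (H.dinc_nonneg j hj) ?_
  exact sub_nonneg.2 (H.term_nonneg n j k (Finset.mem_Icc.1 hj).2)

lemma ModelX.gap_le (H : ModelX μ m a f X) (n k : ℕ) (C : ℝ)
    (hC : ∀ j, 1 ≤ j → j ≤ m → min (k : ℝ) (∑ i ∈ Icc 1 j, (n : ℝ) * f i)
      - ∫ ω, min (k : ℝ) (Wc a X n j ω) ∂μ ≤ C) :
    DRval m a f n k - Voff μ m a X n k ≤ a 1 * C := by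
  rw [H.gap_eq, ← dinc_sum a m H.hm, Finset.sum_mul]
  refine Finset.sum_le_sum fun j hj => mul_le_mul_of_nonneg_left ?_ (H.dinc_nonneg j hj)
  rw [Finset.mem_Icc] at hj
  exact hC j hj.1 hj.2

lemma ModelX.a1_pos (H : ModelX μ m a f X) : 0 < a 1 := by
  rcases H.hm.eq_or_lt with h | h
  · rw [h]; exact H.ha_pos
  · exact H.ha_pos.trans (H.anti 1 m le_rfl h le_rfl)

lemma ModelX.sqrt_bound (H : ModelX μ m a f X) (n k : ℕ) (hk : k ≤ n) :
    DRval m a f n k - Voff μ m a X n k ≤ a 1 * Real.sqrt n := by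
  refine H.gap_le n k _ fun j _ hj => ?_
  rcases Nat.eq_zero_or_pos n with rfl | hn
  · obtain rfl : k = 0 := by omega
    simp [Wc, Zc]
  · have hn' : (0:ℝ) < n := by exact_mod_cast hn
    have hs : 0 < Real.sqrt n := Real.sqrt_pos.2 hn'
    have h := H.term_le n j k hj 0 (1 / (2 * Real.sqrt n)) (Real.sqrt n / 2) (by positivity)
      (fun w => quad1 _ _ w _ hs)
    have h2 : 1 / (2 * Real.sqrt n) * n + Real.sqrt n / 2 = Real.sqrt n := by
      field_simp
      rw [Real.sq_sqrt hn'.le]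
      ring
    linarith

lemma ModelX.const_bound (H : ModelX μ m a f X) (n k : ℕ) (e : ℝ) (he : 0 < e)
    (j : ℕ) (hj1 : 1 ≤ j) (hjm : j ≤ m) (h1 : Fbar f j + e ≤ (k : ℝ) / (n : ℝ))
    (h2 : (k : ℝ) / (n : ℝ) ≤ Fbar f (j + 1) - e) :
    DRval m a f n k - Voff μ m a X n k ≤ a 1 * m / (4 * e) := by
  have hmono : ∀ p q, p ≤ q → q ≤ m → ∑ i ∈ Icc 1 p, f i ≤ ∑ i ∈ Icc 1 q, f i := by
    intro p q hpq hq
    refine Finset.sum_le_sum_of_subset_of_nonneg (Finset.Icc_subset_Icc le_rfl hpq) ?_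
    intro i hi _
    rw [Finset.mem_Icc] at hi
    exact (H.hf_pos i hi.1 (hi.2.trans hq)).le
  have hn : (0:ℝ) < n := by
    rcases Nat.eq_zero_or_pos n with rfl | hn
    · have := hmono 0 (j - 1) (by omega) (by omega)
      simp at this
      simp [Fbar] at h1
      linarith
    · exact_mod_cast hn
  unfold Fbar at h1 h2
  rw [le_div_iff₀ hn] at h1
  rw [div_le_iff₀ hn, Nat.add_sub_cancel] at h2
  have hc : 0 < n * e := by positivity
  have hval : 1 / (4 * (n * e)) * n + 0 = 1 / (4 * e) := by field_simp; ring
  have hg := H.gap_le n k (1 / (4 * e)) fun p _ hp => by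
    rw [← hval]
    rcases Nat.lt_or_ge p j with h | h
    · refine H.term_le n p k hp (-1) (1 / (4 * (n * e))) 0 (by positivity) fun w => ?_
      have := quad2 k (∑ i ∈ Icc 1 p, (n : ℝ) * f i) w _ hc (by
        rw [← Finset.mul_sum]
        nlinarith [hmono p (j - 1) (by omega) (by omega)])
      linarith
    · refine H.term_le n p k hp 0 (1 / (4 * (n * e))) 0 (by positivity) fun w => ?_
      exact quad3 k (∑ i ∈ Icc 1 p, (n : ℝ) * f i) w _ hc (by
        rw [← Finset.mul_sum]
        nlinarith [hmono j p h hp])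
  refine hg.trans ?_
  rw [mul_one_div]
  have : (1:ℝ) ≤ m := by exact_mod_cast H.hm
  have := H.a1_pos
  gcongr
  nlinarith

end

/-- Proposition 5, deterministic relaxation gap: there is a constant
`M ≡ M(ε, m, a_1, …, a_m)` with `0 ≤ DR(n,k) - V_off^*(n,k) ≤ M √n` on all of `𝒯`, while on
`𝒯' = {(n,k) : F̄(a_j) + ε' ≤ k/n ≤ F̄(a_{j+1}) - ε' for some j ∈ [m]}` the gap is at most
`a_1 m/(4ε')`. -/
theorem deterministic_relaxation_gap (ε : ℝ) (m : ℕ) (a : ℕ → ℝ) :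
    ∃ M : ℝ,
      ∀ (Ω : Type) [MeasurableSpace Ω] (μ : Measure Ω) (f : ℕ → ℝ) (X : ℕ → Ω → ℝ),
        ModelX μ m a f X → ε = minf m f / 2 →
        ∀ n k : ℕ, k ≤ n →
          (0 ≤ DRval m a f n k - Voff μ m a X n k ∧
            DRval m a f n k - Voff μ m a X n k ≤ M * Real.sqrt n) ∧
          (∀ ε' : ℝ, 0 < ε' → ε' < ε →
            (∃ j, 1 ≤ j ∧ j ≤ m ∧
                Fbar f j + ε' ≤ (k : ℝ) / (n : ℝ) ∧ (k : ℝ) / (n : ℝ) ≤ Fbar f (j + 1) - ε') →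
            0 ≤ DRval m a f n k - Voff μ m a X n k ∧
              DRval m a f n k - Voff μ m a X n k ≤ a 1 * m / (4 * ε')) := by
  refine ⟨a 1, ?_⟩
  intro Ω _ μ f X H _ n k hk
  refine ⟨⟨H.gap_nonneg n k, H.sqrt_bound n k hk⟩, ?_⟩
  rintro e he _ ⟨j, h1, h2, h3, h4⟩
  exact ⟨H.gap_nonneg n k, H.const_bound n k e he j h1 h2 h3 h4⟩

end MultiSecretary
end
end
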